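/- Let p > 1, D the unit disk, S the unit circle. Every Φ ∈ HD_p(D) has nontangential limits almost everywhere on S defining a boundary function E(Φ) ∈ B_p(S), and for every φ ∈ B_p(S) the Poisson integral P(φ)(z) = (1/2π)∫_S ((1−|z|²)/|ζ−z|²) φ(ζ)|dζ| belongs to HD_p(D). The boundary extension operator E : HD_p(D) → B_p(S) and the Poisson integral operator P : B_p(S) → HD_p(D) are Banach-space isomorphisms with P^{-1} = E. -/

import Mathlib

/-!
Common definitions used to formalize the statements of
"Transmission of harmonic functions through quasicircles on compact Riemann surfaces".

We model the extended plane by working with planar representations of sphere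
self-homeomorphisms (recording the preimage/image of `∞` as `Option ℂ` data,
`none` standing for `∞` itself).
-/

open Complex MeasureTheory Metric Set Filter Topology Bornology
open scoped Real ENNReal ComplexConjugate

noncomputable section

namespace WPPaper

/-! ### Basic sets and curves -/

def unitCircleSet : Set ℂ := Metric.sphere (0 : ℂ) 1

def unitDiskSet : Set ℂ := Metric.ball (0 : ℂ) 1

def extDiskSet : Set ℂ := {z : ℂ | 1 < ‖z‖}

/-- Arc-length (angle) parametrization of the unit circle. -/
def circlePt (θ : ℝ) : ℂ := Complex.exp (θ * Complex.I)

/-- A closed Jordan curve in `ℂ`: a homeomorphic image of the unit circle. -/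
def IsJordanCurve (Γ : Set ℂ) : Prop :=
  ∃ f : ℂ → ℂ, ContinuousOn f unitCircleSet ∧ InjOn f unitCircleSet ∧
    f '' unitCircleSet = Γ

/-- `A` and `B` are the two complementary subarcs of the Jordan curve `Γ`
between the points `z₁, z₂ ∈ Γ`. -/
def IsArcPair (Γ : Set ℂ) (z₁ z₂ : ℂ) (A B : Set ℂ) : Prop :=
  A ∪ B = Γ ∧ A ∩ B = {z₁, z₂} ∧ IsClosed A ∧ IsClosed B ∧
    IsConnected A ∧ IsConnected B

/-- `Ω` is one of the two complementary (Jordan) domains of the Jordan curve `Γ`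
(as a planar set; the unbounded component represents the component of
`Ĉ ∖ Γ` containing `∞` with the point `∞` removed). -/
def IsJordanComplComponent (Ω Γ : Set ℂ) : Prop :=
  IsJordanCurve Γ ∧ IsOpen Ω ∧ IsPreconnected Ω ∧ Ω ∩ Γ = ∅ ∧ frontier Ω = Γ

/-! ### Hyperbolic densities -/

/-- Hyperbolic density of the unit disk (normalized to curvature `-4`). -/
def rhoD (z : ℂ) : ℝ := (1 - ‖z‖ ^ 2)⁻¹

/-- Hyperbolic density of the exterior disk `𝔻* = {|z| > 1} ∪ {∞}`. -/
def rhoDStar (z : ℂ) : ℝ := (‖z‖ ^ 2 - 1)⁻¹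

/-- Hyperbolic (Poincaré) density of a hyperbolic planar domain `Ω`, normalized so that
`hypDensity unitDiskSet = rhoD`; defined via the extremal (covering) map from the disk. -/
def hypDensity (Ω : Set ℂ) (z : ℂ) : ℝ :=
  (sSup {r : ℝ | ∃ f : ℂ → ℂ, DifferentiableOn ℂ f unitDiskSet ∧
    MapsTo f unitDiskSet Ω ∧ f 0 = z ∧ r = ‖deriv f 0‖})⁻¹

/-- The constant weight `1`; for `p = 2` the hyperbolic weights in the Dirichlet
integral cancel, so the `2`-Dirichlet integral is the unweighted one. -/
def constOne : ℂ → ℝ := fun _ => 1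

/-! ### Harmonic functions and Dirichlet integrals -/

/-- `|∇f(z)|`. -/
def gradNorm (f : ℂ → ℂ) (z : ℂ) : ℝ :=
  Real.sqrt (‖fderiv ℝ f z 1‖ ^ 2 + ‖fderiv ℝ f z Complex.I‖ ^ 2)

/-- `|∇f(z)|` computed from a given (weak) derivative. -/
def gradNormL (L : ℂ →L[ℝ] ℂ) : ℝ := Real.sqrt (‖L 1‖ ^ 2 + ‖L Complex.I‖ ^ 2)

/-- `f` is (complex-valued) harmonic on `Ω`: it is `C²` there and its Laplacian vanishes. -/
def IsHarmonicOn (f : ℂ → ℂ) (Ω : Set ℂ) : Prop :=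
  ContDiffOn ℝ 2 f Ω ∧ ∀ z ∈ Ω,
    fderiv ℝ (fun w => fderiv ℝ f w 1) z 1 +
      fderiv ℝ (fun w => fderiv ℝ f w Complex.I) z Complex.I = 0

/-- The `p`-Dirichlet energy `∫_Ω (|∇f| ρ⁻¹)^p ρ² dxdy` with weight `ρ`. -/
def dirichletEnergy (p : ℝ) (ρ : ℂ → ℝ) (f : ℂ → ℂ) (Ω : Set ℂ) : ℝ≥0∞ :=
  ∫⁻ z in Ω, ENNReal.ofReal ((gradNorm f z * (ρ z)⁻¹) ^ p * (ρ z) ^ 2)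

/-- The `p`-Dirichlet norm `‖f‖_{D_p}` with weight `ρ`. -/
def dirichletNorm (p : ℝ) (ρ : ℂ → ℝ) (f : ℂ → ℂ) (Ω : Set ℂ) : ℝ≥0∞ :=
  dirichletEnergy p ρ f Ω ^ (1 / p)

/-- `f ∈ HD_p(Ω)`: a `p`-Dirichlet finite harmonic function on `Ω` (weight `ρ`). -/
def MemHD (p : ℝ) (ρ : ℂ → ℝ) (f : ℂ → ℂ) (Ω : Set ℂ) : Prop :=
  IsHarmonicOn f Ω ∧ dirichletEnergy p ρ f Ω < ⊤

/-! ### Weak derivatives, Sobolev energies -/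

/-- `f'` is a weak (distributional) derivative of `f` on `Ω`. -/
def HasWeakFDerivOn (f : ℂ → ℂ) (f' : ℂ → ℂ →L[ℝ] ℂ) (Ω : Set ℂ) : Prop :=
  LocallyIntegrableOn f Ω volume ∧
  (∀ v : ℂ, LocallyIntegrableOn (fun z => f' z v) Ω volume) ∧
  ∀ ψ : ℂ → ℝ, ContDiff ℝ (⊤ : ℕ∞) ψ → HasCompactSupport ψ → tsupport ψ ⊆ Ω →
    ∀ v : ℂ, ∫ z in Ω, ψ z • f' z v = -∫ z in Ω, fderiv ℝ ψ z v • f z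

/-- The derivative `f'` is locally square integrable on `Ω` (`W^{1,2}_loc`). -/
def W12locOn (f' : ℂ → ℂ →L[ℝ] ℂ) (Ω : Set ℂ) : Prop :=
  ∀ K : Set ℂ, K ⊆ Ω → IsCompact K → (∫⁻ z in K, (‖f' z‖₊ : ℝ≥0∞) ^ 2) < ⊤

/-- The weighted `p`-Sobolev (Dirichlet) energy computed from a weak derivative. -/
def sobolevEnergyW (p : ℝ) (ρ : ℂ → ℝ) (f' : ℂ → ℂ →L[ℝ] ℂ) (Ω : Set ℂ) : ℝ≥0∞ :=
  ∫⁻ z in Ω, ENNReal.ofReal ((gradNormL (f' z) * (ρ z)⁻¹) ^ p * (ρ z) ^ 2)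

/-- The function with weak derivative `g'` can be approximated, in the weighted
`p`-Dirichlet seminorm, by smooth compactly supported functions on `Ω`;
i.e. it lies in the closure of `C₀^∞(Ω)`. -/
def ApproxByTest (p : ℝ) (ρ : ℂ → ℝ) (g' : ℂ → ℂ →L[ℝ] ℂ) (Ω : Set ℂ) : Prop :=
  ∀ ε : ℝ, 0 < ε → ∃ ψ : ℂ → ℂ, ContDiff ℝ (⊤ : ℕ∞) ψ ∧ HasCompactSupport ψ ∧ tsupport ψ ⊆ Ω ∧
    sobolevEnergyW p ρ (fun z => g' z - fderiv ℝ ψ z) Ω < ENNReal.ofReal ε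

/-! ### Wirtinger derivatives and quasiconformal maps -/

def wirtingerD (L : ℂ →L[ℝ] ℂ) : ℂ := (L 1 - Complex.I * L Complex.I) / 2

def wirtingerDBar (L : ℂ →L[ℝ] ℂ) : ℂ := (L 1 + Complex.I * L Complex.I) / 2

/-- `f` is a `K`-quasiconformal homeomorphism of `Ω` onto `Ω'`:
an orientation-preserving homeomorphism in `W^{1,2}_loc` whose Beltrami coefficient
satisfies `|μ| ≤ (K-1)/(K+1)` a.e. -/
def IsQCOn (f : ℂ → ℂ) (Ω Ω' : Set ℂ) (K : ℝ) : Prop :=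
  1 ≤ K ∧ ContinuousOn f Ω ∧ BijOn f Ω Ω' ∧
  (∃ g : ℂ → ℂ, ContinuousOn g Ω' ∧ InvOn g f Ω Ω') ∧
  ∃ f' : ℂ → ℂ →L[ℝ] ℂ, HasWeakFDerivOn f f' Ω ∧ W12locOn f' Ω ∧
    ∀ᵐ z ∂volume.restrict Ω,
      ‖wirtingerDBar (f' z)‖ ≤ (K - 1) / (K + 1) * ‖wirtingerD (f' z)‖

/-- `f` is a quasiconformal homeomorphism of `Ω` onto `Ω'` with complex dilatation
(Beltrami coefficient) `μ`. -/
def IsQCWithBeltrami (f : ℂ → ℂ) (Ω Ω' : Set ℂ) (μ : ℂ → ℂ) : Prop :=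
  ContinuousOn f Ω ∧ BijOn f Ω Ω' ∧
  (∃ g : ℂ → ℂ, ContinuousOn g Ω' ∧ InvOn g f Ω Ω') ∧
  ∃ f' : ℂ → ℂ →L[ℝ] ℂ, HasWeakFDerivOn f f' Ω ∧ W12locOn f' Ω ∧
    ∀ᵐ z ∂volume.restrict Ω, wirtingerDBar (f' z) = μ z * wirtingerD (f' z)

/-- `Γ` is a `K`-quasicircle: the image of the unit circle under a `K`-quasiconformal
self-homeomorphism of `ℂ`. -/
def IsKQuasicircle (Γ : Set ℂ) (K : ℝ) : Prop :=
  ∃ f : ℂ → ℂ, IsQCOn f univ univ K ∧ f '' unitCircleSet = Γ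

def IsQuasicircle (Γ : Set ℂ) : Prop := ∃ K : ℝ, IsKQuasicircle Γ K

/-- `Γ` is a chord-arc curve: the image of the unit circle under a bi-Lipschitz
self-homeomorphism of `ℂ`. -/
def IsChordArcCurve (Γ : Set ℂ) : Prop :=
  ∃ f : ℂ → ℂ, Function.Bijective f ∧
    (∃ L : ℝ, 1 ≤ L ∧ (∀ z w : ℂ, ‖f z - f w‖ ≤ L * ‖z - w‖) ∧
      (∀ z w : ℂ, ‖z - w‖ ≤ L * ‖f z - f w‖)) ∧
    f '' unitCircleSet = Γ

/-! ### Circle homeomorphisms and quasisymmetry -/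

/-- `h` is an orientation-preserving homeomorphism of the unit circle onto itself
(encoded by a continuous strictly increasing degree-one lift). -/
def IsCircleHomeo (h : ℂ → ℂ) : Prop :=
  ∃ H : ℝ → ℝ, Continuous H ∧ StrictMono H ∧ (∀ θ, H (θ + 2 * π) = H θ + 2 * π) ∧
    ∀ θ, h (circlePt θ) = circlePt (H θ)

/-- `h` is a quasisymmetric homeomorphism of the unit circle: an orientation-preserving
circle homeomorphism extending to a quasiconformal self-homeomorphism of the disk. -/
def IsQuasisymmetric (h : ℂ → ℂ) : Prop :=
  IsCircleHomeo h ∧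
  ∃ (Hext : ℂ → ℂ) (K : ℝ), IsQCOn Hext unitDiskSet unitDiskSet K ∧
    ContinuousOn Hext (closure unitDiskSet) ∧ ∀ ζ ∈ unitCircleSet, Hext ζ = h ζ

/-- Normalization: fixing the three boundary points `1`, `i`, `-i`. -/
def FixesNormalization (f : ℂ → ℂ) : Prop :=
  f 1 = 1 ∧ f Complex.I = Complex.I ∧ f (-Complex.I) = -Complex.I

/-! ### Besov spaces on the circle and on rectifiable curves -/

def besovEnergy (p : ℝ) (φ : ℂ → ℂ) : ℝ≥0∞ :=
  ∫⁻ x in Ioc (0 : ℝ) (2 * π), ∫⁻ y in Ioc (0 : ℝ) (2 * π),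
    ENNReal.ofReal (‖φ (circlePt x) - φ (circlePt y)‖ ^ p
      / ‖circlePt x - circlePt y‖ ^ (2 : ℕ))

def besovNorm (p : ℝ) (φ : ℂ → ℂ) : ℝ≥0∞ := besovEnergy p φ ^ (1 / p)

/-- `φ ∈ B_p(𝕊)`: the homogeneous `p`-Besov space on the unit circle. -/
def MemBesov (p : ℝ) (φ : ℂ → ℂ) : Prop :=
  IntegrableOn (fun θ : ℝ => φ (circlePt θ)) (Ioc 0 (2 * π)) volume ∧
  besovEnergy p φ < ⊤

/-- Besov energy on a rectifiable curve `Γ`, with respect to arc length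
(one-dimensional Hausdorff measure). -/
def besovEnergyCurve (p : ℝ) (Γ : Set ℂ) (φ : ℂ → ℂ) : ℝ≥0∞ :=
  ∫⁻ x in Γ, ∫⁻ y in Γ,
    ENNReal.ofReal (‖φ x - φ y‖ ^ p / ‖x - y‖ ^ (2 : ℕ)) ∂μH[1] ∂μH[1]

def besovNormCurve (p : ℝ) (Γ : Set ℂ) (φ : ℂ → ℂ) : ℝ≥0∞ :=
  besovEnergyCurve p Γ φ ^ (1 / p)

/-- `φ ∈ B_p(Γ)`: `φ ∈ L_p(Γ)` with finite Besov energy on `Γ`. -/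
def MemBesovCurve (p : ℝ) (Γ : Set ℂ) (φ : ℂ → ℂ) : Prop :=
  (∫⁻ x in Γ, ENNReal.ofReal (‖φ x‖ ^ p) ∂μH[1]) < ⊤ ∧ besovEnergyCurve p Γ φ < ⊤

/-! ### Nontangential limits and Poisson integrals -/

/-- Nontangential approach region in `Ω` at the boundary point `ζ` with aperture `M`. -/
def ntRegion (Ω : Set ℂ) (ζ : ℂ) (M : ℝ) : Set ℂ :=
  {z ∈ Ω | ‖z - ζ‖ < M * Metric.infDist z (frontier Ω)}

/-- `f` has nontangential limit `L` at the boundary point `ζ` of `Ω`. -/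
def HasNTLimAt (f : ℂ → ℂ) (Ω : Set ℂ) (L : ℂ) (ζ : ℂ) : Prop :=
  ∀ M : ℝ, 1 < M → Tendsto f (𝓝[ntRegion Ω ζ M] ζ) (𝓝 L)

/-- `φ` is the nontangential boundary-value function on `Γ` of `f : Ω → ℂ`
(a.e. with respect to arc length on `Γ`). -/
def IsNTBoundaryFun (f : ℂ → ℂ) (Ω Γ : Set ℂ) (φ : ℂ → ℂ) : Prop :=
  ∀ᵐ ζ ∂(μH[1] : Measure ℂ).restrict Γ, HasNTLimAt f Ω (φ ζ) ζ

/-- The Poisson integral on the unit disk: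
`P(φ)(z) = (1/2π) ∫_𝕊 (1-|z|²)/|ζ-z|² φ(ζ) |dζ|`. -/
def poissonDisk (φ : ℂ → ℂ) (z : ℂ) : ℂ :=
  (2 * π)⁻¹ • ∫ θ in Ioc (0 : ℝ) (2 * π),
    ((1 - ‖z‖ ^ 2) / ‖circlePt θ - z‖ ^ 2) • φ (circlePt θ)

/-- The Poisson integral on the exterior disk. -/
def poissonExt (φ : ℂ → ℂ) (z : ℂ) : ℂ :=
  (2 * π)⁻¹ • ∫ θ in Ioc (0 : ℝ) (2 * π),
    ((‖z‖ ^ 2 - 1) / ‖circlePt θ - z‖ ^ 2) • φ (circlePt θ)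

/-! ### Integrable Beltrami coefficients -/

/-- `μ ∈ M_p(Ω)`: a Beltrami coefficient on `Ω` (`‖μ‖_∞ < 1`) that is `p`-integrable
with respect to the hyperbolic metric with density `ρ`. -/
def MemMp (p : ℝ) (μ : ℂ → ℂ) (Ω : Set ℂ) (ρ : ℂ → ℝ) : Prop :=
  AEStronglyMeasurable μ (volume.restrict Ω) ∧
  (∃ k : ℝ, k < 1 ∧ ∀ᵐ z ∂volume.restrict Ω, ‖μ z‖ ≤ k) ∧
  (∫⁻ z in Ω, ENNReal.ofReal (‖μ z‖ ^ p * (ρ z) ^ 2)) < ⊤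

/-! ### Self-maps of the Riemann sphere, in planar representation -/

/-- The filter of neighborhoods of `∞` in `Ĉ`, restricted to `ℂ`. -/
def cobdd : Filter ℂ := Bornology.cobounded ℂ

/-- The planar set attached to an `Option ℂ` datum (`none` stands for `∞`). -/
def optSet (o : Option ℂ) : Set ℂ := o.elim ∅ (fun a => {a})

/-- `f : ℂ → ℂ` is the planar representation of a self-homeomorphism of the Riemann
sphere `Ĉ`, where `zP` is the preimage of `∞` and `wP` the image of `∞`
(`none` standing for `∞`). The value of `f` on its pole is irrelevant. -/
def IsSphereHomeo (f : ℂ → ℂ) (zP wP : Option ℂ) : Prop :=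
  match zP, wP with
  | none, none =>
      Continuous f ∧ Function.Bijective f ∧
      (∃ g : ℂ → ℂ, Continuous g ∧ Function.LeftInverse g f ∧ Function.RightInverse g f) ∧
      Tendsto f cobdd cobdd
  | some a, some b =>
      ContinuousOn f {a}ᶜ ∧ BijOn f {a}ᶜ {b}ᶜ ∧
      (∃ g : ℂ → ℂ, ContinuousOn g {b}ᶜ ∧ InvOn g f {a}ᶜ {b}ᶜ) ∧
      Tendsto f (𝓝[≠] a) cobdd ∧ Tendsto f cobdd (𝓝 b)
  | _, _ => False

/-- The (planar representation of the) sphere homeomorphism `f` has complex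
dilatation `μ` a.e. on the planar set `A` (away from its pole `zP`). -/
def SphereBeltramiOn (f : ℂ → ℂ) (zP : Option ℂ) (μ : ℂ → ℂ) (A : Set ℂ) : Prop :=
  ∃ f' : ℂ → ℂ →L[ℝ] ℂ, HasWeakFDerivOn f f' (A \ optSet zP) ∧
    W12locOn f' (A \ optSet zP) ∧
    ∀ᵐ z ∂volume.restrict (A \ optSet zP),
      wirtingerDBar (f' z) = μ z * wirtingerD (f' z)

/-- The sphere homeomorphism `f` is `K`-quasiconformal on the planar set `A`. -/
def SphereQCBddOn (f : ℂ → ℂ) (zP : Option ℂ) (K : ℝ) (A : Set ℂ) : Prop :=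
  ∃ f' : ℂ → ℂ →L[ℝ] ℂ, HasWeakFDerivOn f f' (A \ optSet zP) ∧
    W12locOn f' (A \ optSet zP) ∧
    ∀ᵐ z ∂volume.restrict (A \ optSet zP),
      ‖wirtingerDBar (f' z)‖ ≤ (K - 1) / (K + 1) * ‖wirtingerD (f' z)‖

/-- Planar representation of a quasiconformal self-homeomorphism of `Ĉ` fixing
`1, i, -i`, with complex dilatation `μ₁` on the unit disk and `μ₂` on the exterior disk. -/
def IsGMap (f : ℂ → ℂ) (zP wP : Option ℂ) (μ₁ μ₂ : ℂ → ℂ) : Prop :=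
  IsSphereHomeo f zP wP ∧
  SphereBeltramiOn f zP μ₁ unitDiskSet ∧
  SphereBeltramiOn f zP μ₂ extDiskSet ∧
  FixesNormalization f

/-- `Γ ⊂ ℂ` is a `p`-Weil–Petersson curve: the image of the unit circle under the
normalized quasiconformal self-map `F_μ` of `Ĉ` with dilatation `μ ∈ M_p(𝔻*)` on `𝔻*`
and `0` on `𝔻`. -/
def IsWPCurve (p : ℝ) (Γ : Set ℂ) : Prop :=
  ∃ μ : ℂ → ℂ, MemMp p μ extDiskSet rhoDStar ∧
  ∃ (f : ℂ → ℂ) (zP wP : Option ℂ), IsGMap f zP wP (fun _ => 0) μ ∧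
    optSet zP ∩ unitCircleSet = ∅ ∧ f '' unitCircleSet = Γ

/-- The reflection of a Beltrami coefficient on `𝔻*` to one on `𝔻`
under `z ↦ 1/z̄`. -/
def reflectBeltrami (ν : ℂ → ℂ) : ℂ → ℂ :=
  fun z => conj (ν ((conj z)⁻¹)) * z ^ 2 / (conj z) ^ 2

/-- `H = H^ν`: the quasiconformal self-homeomorphism of the unit disk with complex
dilatation `ν`, extended homeomorphically to the closed disk, fixing `1, i, -i`. -/
def IsNormalizedQCDisk (H : ℂ → ℂ) (ν : ℂ → ℂ) : Prop :=
  IsQCWithBeltrami H unitDiskSet unitDiskSet ν ∧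
  ContinuousOn H (closure unitDiskSet) ∧
  BijOn H (closure unitDiskSet) (closure unitDiskSet) ∧
  (∃ g : ℂ → ℂ, ContinuousOn g (closure unitDiskSet) ∧
    InvOn g H (closure unitDiskSet) (closure unitDiskSet)) ∧
  FixesNormalization H

/-! ### Riemann mappings of the complementary domains of a Jordan curve -/

/-- Normalized Riemann mapping from the unit disk onto the complementary domain `Ω`
(planar part) of the Jordan curve `Γ`, extended by Carathéodory to the boundary and
fixing `1, i, -i`; `zP` records a possible pole (when `∞ ∈ Ω` as a `Ĉ`-domain). -/
def IsDiskRiemannTo (F : ℂ → ℂ) (zP : Option ℂ) (Ω Γ : Set ℂ) : Prop :=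
  DifferentiableOn ℂ F (unitDiskSet \ optSet zP) ∧
  optSet zP ⊆ unitDiskSet ∧
  ContinuousOn F (closure unitDiskSet \ optSet zP) ∧
  InjOn F (closure unitDiskSet \ optSet zP) ∧
  F '' unitCircleSet = Γ ∧ FixesNormalization F ∧
  (match zP with
   | none => BijOn F unitDiskSet Ω
   | some a => BijOn F (unitDiskSet \ {a}) Ω ∧ Tendsto F (𝓝[≠] a) cobdd)

/-- Normalized Riemann mapping from the exterior disk `𝔻* = {|z|>1} ∪ {∞}` onto the
complementary domain `Ω` (planar part) of the Jordan curve `Γ`; `zP` records a possible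
pole in `{|z|>1}` and `wP` the (finite) image of `∞`, `none` standing for `∞`. -/
def IsExtRiemannTo (F : ℂ → ℂ) (zP wP : Option ℂ) (Ω Γ : Set ℂ) : Prop :=
  DifferentiableOn ℂ F (extDiskSet \ optSet zP) ∧
  optSet zP ⊆ extDiskSet ∧
  ContinuousOn F ((unitCircleSet ∪ extDiskSet) \ optSet zP) ∧
  InjOn F ((unitCircleSet ∪ extDiskSet) \ optSet zP) ∧
  F '' unitCircleSet = Γ ∧ FixesNormalization F ∧
  (match zP, wP with
   | none, none => BijOn F extDiskSet Ω ∧ Tendsto F cobdd cobdd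
   | none, some b => b ∈ Ω ∧ BijOn F extDiskSet (Ω \ {b}) ∧ Tendsto F cobdd (𝓝 b)
   | some a, some b => b ∈ Ω ∧ BijOn F (extDiskSet \ {a}) (Ω \ {b}) ∧
       Tendsto F (𝓝[≠] a) cobdd ∧ Tendsto F cobdd (𝓝 b)
   | some _, none => False)

/-- The transmission relation across `Γ`: `Φ₂` is obtained from `Φ₁` by the composition
`(F₂)_* ∘ P₂ ∘ C_{h_Γ} ∘ E₁ ∘ (F₁)^*`, i.e. `Φ₂ ∘ F₂ = P₂(E₁(Φ₁ ∘ F₁) ∘ h_Γ)` on the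
exterior disk (away from the pole of `F₂`). -/
def TransRel (F₁ F₂ h : ℂ → ℂ) (zP : Option ℂ) (Φ₁ Φ₂ : ℂ → ℂ) : Prop :=
  ∃ φ : ℂ → ℂ,
    IsNTBoundaryFun (fun z => Φ₁ (F₁ z)) unitDiskSet unitCircleSet φ ∧
    ∀ z ∈ extDiskSet \ optSet zP, Φ₂ (F₂ z) = poissonExt (fun ζ => φ (h ζ)) z

/-! ### Hilbert transform, Szegő projection, analytic Besov space -/

/-- Truncated Hilbert transform on the circle (for the principal value). -/
def hilbertTrunc (φ : ℂ → ℂ) (θ ε : ℝ) : ℂ :=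
  (π * Complex.I)⁻¹ * ∫ t in Ioc (θ - π) (θ + π) \ Ioo (θ - ε) (θ + ε),
    φ (circlePt t) / (circlePt t - circlePt θ) * (Complex.I * circlePt t)

/-- `ψ = 𝓗(φ)` a.e. on the circle: `ψ` is the principal-value Hilbert transform of `φ`. -/
def IsHilbertTransformOf (ψ φ : ℂ → ℂ) : Prop :=
  ∀ᵐ θ ∂volume.restrict (Ioc (0 : ℝ) (2 * π)),
    Tendsto (fun ε : ℝ => hilbertTrunc φ θ ε) (𝓝[>] (0 : ℝ)) (𝓝 (ψ (circlePt θ)))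

/-- The Szegő projection (Cauchy integral) `𝓢(φ)(z) = (1/2πi) ∫_𝕊 φ(ζ)/(ζ-z) dζ`. -/
def szego (φ : ℂ → ℂ) (z : ℂ) : ℂ :=
  (2 * π * Complex.I)⁻¹ * ∫ t in Ioc (0 : ℝ) (2 * π),
    φ (circlePt t) / (circlePt t - z) * (Complex.I * circlePt t)

/-- Energy of the `p`-analytic Besov space `𝓑_p(𝔻)`. -/
def analyticBesovEnergy (p : ℝ) (f : ℂ → ℂ) : ℝ≥0∞ :=
  ∫⁻ z in unitDiskSet, ENNReal.ofReal ((‖deriv f z‖ * (rhoD z)⁻¹) ^ p * (rhoD z) ^ 2)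

def analyticBesovNorm (p : ℝ) (f : ℂ → ℂ) : ℝ≥0∞ := analyticBesovEnergy p f ^ (1 / p)

/-- `f ∈ 𝓑_p(𝔻)`: holomorphic on the unit disk with finite `p`-Besov energy. -/
def MemAnalyticBesov (p : ℝ) (f : ℂ → ℂ) : Prop :=
  DifferentiableOn ℂ f unitDiskSet ∧ analyticBesovEnergy p f < ⊤

/-! ### The p-integrable Teichmüller space -/

/-- Distance `‖μ - ν‖_p + ‖μ - ν‖_∞` on Beltrami coefficients of the disk. -/
def mpDist (p : ℝ) (μ ν : ℂ → ℂ) : ℝ :=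
  ((∫⁻ z in unitDiskSet, ENNReal.ofReal (‖μ z - ν z‖ ^ p * (rhoD z) ^ 2)) ^ (1 / p)).toReal +
  (essSup (fun z => (‖μ z - ν z‖₊ : ℝ≥0∞)) (volume.restrict unitDiskSet)).toReal

/-- The space `M_p(𝔻)` of `p`-integrable Beltrami coefficients on the disk. -/
def MpD (p : ℝ) : Type := {μ : ℂ → ℂ // MemMp p μ unitDiskSet rhoD}

/-- The topology induced by the norm `‖·‖_p + ‖·‖_∞` on `M_p(𝔻)`. -/
instance (p : ℝ) : TopologicalSpace (MpD p) :=
  TopologicalSpace.generateFrom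
    {U | ∃ (μ₀ : MpD p) (ε : ℝ), U = {μ : MpD p | mpDist p μ.1 μ₀.1 < ε}}

/-- Teichmüller equivalence: the normalized quasiconformal extensions have the same
boundary values on the circle. -/
def teichRel (p : ℝ) (μ ν : MpD p) : Prop :=
  ∃ H₁ H₂ : ℂ → ℂ, IsNormalizedQCDisk H₁ μ.1 ∧ IsNormalizedQCDisk H₂ ν.1 ∧
    EqOn H₁ H₂ unitCircleSet

/-- The `p`-integrable Teichmüller space `T_p` with the quotient topology. -/
def TeichSpace (p : ℝ) : Type := Quot (teichRel p)

def TeichSpace.mk (p : ℝ) (μ : MpD p) : TeichSpace p := Quot.mk (teichRel p) μ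

instance (p : ℝ) : TopologicalSpace (TeichSpace p) :=
  TopologicalSpace.coinduced (TeichSpace.mk p) inferInstance

/-! ### Arc-length parametrizations and inscribed polygons -/

/-- `γ` is an (L-periodic) arc-length parametrization of the rectifiable Jordan
curve `Γ` of length `L`. -/
def IsArcLengthParam (γ : ℝ → ℂ) (Γ : Set ℂ) (L : ℝ) : Prop :=
  0 < L ∧ ENNReal.ofReal L = μH[1] Γ ∧ Continuous γ ∧ (∀ s, γ (s + L) = γ s) ∧
  γ '' Ico 0 L = Γ ∧ InjOn γ (Ico 0 L) ∧
  ∀ s t : ℝ, s ≤ t → t ≤ s + L → μH[1] (γ '' Icc s t) = ENNReal.ofReal (t - s)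

/-- The length of the inscribed polygon with `2ⁿ` vertices evenly distributed with
respect to arc length, starting at `γ s₀`. -/
def inscribedPolygonLength (γ : ℝ → ℂ) (L s₀ : ℝ) (n : ℕ) : ℝ :=
  ∑ k ∈ Finset.range (2 ^ n),
    ‖γ (s₀ + (k + 1) * (L / 2 ^ n)) - γ (s₀ + k * (L / 2 ^ n))‖

@[fun_prop]
theorem continuous_circlePt : Continuous circlePt := by
  unfold circlePt; fun_prop

@[simp]
theorem norm_circlePt (θ : ℝ) : ‖circlePt θ‖ = 1 := Complex.norm_exp_ofReal_mul_I θ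

theorem circlePt_periodic : Function.Periodic circlePt (2 * π) := by
  intro θ
  simp only [circlePt]
  push_cast
  rw [add_mul, Complex.exp_add, Complex.exp_two_pi_mul_I, mul_one]

theorem norm_circlePt_sub (x y : ℝ) :
    ‖circlePt x - circlePt y‖ = 2 * |Real.sin ((x - y) / 2)| := by
  have h : circlePt x - circlePt y = circlePt y * (Complex.exp (I * (x - y : ℝ)) - 1) := by
    simp only [circlePt, mul_sub, ← Complex.exp_add, mul_one]
    congr 2
    push_cast; ring
  rw [h, norm_mul, norm_circlePt, one_mul, Complex.norm_exp_I_mul_ofReal_sub_one]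
  simp

theorem norm_circlePt_sub_le (x y : ℝ) : ‖circlePt x - circlePt y‖ ≤ |x - y| := by
  rw [norm_circlePt_sub]
  have := Real.abs_sin_le_abs (x := (x - y) / 2)
  rw [abs_div, abs_two] at this
  linarith

theorem le_norm_circlePt_sub {x y : ℝ} (h : |x - y| ≤ π) :
    2 / π * |x - y| ≤ ‖circlePt x - circlePt y‖ := by
  rw [norm_circlePt_sub]
  have h1 := Real.mul_le_sin (x := |x - y| / 2) (by positivity) (by linarith)
  have h2 : |Real.sin ((x - y) / 2)| = |Real.sin (|x - y| / 2)| := by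
    rcases abs_cases (x - y) with ⟨h, -⟩ | ⟨h, -⟩ <;> rw [h]
    rw [neg_div, Real.sin_neg, abs_neg]
  rw [h2]
  have := le_abs_self (Real.sin (|x - y| / 2))
  linarith

theorem lipschitzWith_circlePt : LipschitzWith 1 circlePt :=
  LipschitzWith.of_dist_le_mul fun x y => by
    simpa [dist_eq_norm] using norm_circlePt_sub_le x y

/-- The integral of a `2π`-periodic function does not depend on the chosen period interval. -/
theorem lintegral_Ioc_periodic {f : ℝ → ℝ≥0∞} (hf : Function.Periodic f (2 * π)) (a b : ℝ) :
    ∫⁻ x in Ioc a (a + 2 * π), f x = ∫⁻ x in Ioc b (b + 2 * π), f x := by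
  have hT := Real.two_pi_pos
  have : VAddInvariantMeasure (AddSubgroup.zmultiples (2 * π)) ℝ volume :=
    ⟨fun c s _ => measure_preimage_add _ _ _⟩
  exact (isAddFundamentalDomain_Ioc hT a volume).setLIntegral_eq
    (isAddFundamentalDomain_Ioc hT b volume) f
    (fun g x => by
      obtain ⟨n, hn⟩ := AddSubgroup.mem_zmultiples_iff.1 g.2
      have : g +ᵥ x = n • (2 * π) + x := by rw [hn]; rfl
      rw [this, add_comm]
      exact hf.zsmul n x)

/-- Translation invariance of the integral of a `2π`-periodic function over a period. -/
theorem lintegral_Ioc_periodic_add {f : ℝ → ℝ≥0∞} (hf : Function.Periodic f (2 * π)) (a b h : ℝ) :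
    ∫⁻ x in Ioc a (a + 2 * π), f (x + h) = ∫⁻ x in Ioc b (b + 2 * π), f x := by
  have hp : MeasurePreserving (fun x : ℝ => x + h) volume volume :=
    measurePreserving_add_right volume h
  have := hp.setLIntegral_comp_emb (measurableEmbedding_addRight h) f (Ioc a (a + 2 * π))
  rw [this, image_add_const_Ioc, add_right_comm]
  exact lintegral_Ioc_periodic hf _ _

/-- Integration over the unit disk in polar coordinates. -/
theorem lintegral_unitDisk {g : ℂ → ℝ≥0∞} (hg : Measurable g) :
    ∫⁻ z in unitDiskSet, g z = ∫⁻ θ in Ioc (0 : ℝ) (2 * π), ∫⁻ r in Ioo (0 : ℝ) 1,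
      ENNReal.ofReal r * g (r * circlePt θ) := by
  have hm : MeasurableSet unitDiskSet := measurableSet_ball
  rw [← lintegral_indicator hm, ← Complex.lintegral_comp_polarCoord_symm, polarCoord_target,
    Measure.volume_eq_prod, ← Measure.prod_restrict]
  have hpt : ∀ q : ℝ × ℝ, Complex.polarCoord.symm q = q.1 * circlePt q.2 := by
    intro q
    rw [Complex.polarCoord_symm_apply, circlePt, Complex.exp_mul_I]
    push_cast
    rfl
  simp only [hpt, smul_eq_mul]
  have hgi : Measurable (unitDiskSet.indicator g) := hg.indicator hm
  rw [lintegral_prod_symm _ (by fun_prop)]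
  have h1 : ∀ θ : ℝ, ∫⁻ r in Ioi (0 : ℝ), ENNReal.ofReal r *
      unitDiskSet.indicator g (r * circlePt θ) = ∫⁻ r in Ioo (0 : ℝ) 1,
      ENNReal.ofReal r * g (r * circlePt θ) := by
    intro θ
    rw [← lintegral_indicator measurableSet_Ioi, ← lintegral_indicator measurableSet_Ioo]
    refine lintegral_congr fun r => ?_
    by_cases h0 : 0 < r
    · by_cases h1 : r < 1 <;> simp [indicator, h0, h1, unitDiskSet, abs_of_pos]
    · simp [indicator, h0]
  simp only [h1]
  rw [restrict_Ioo_eq_restrict_Ioc (a := -π)]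
  have hper : Function.Periodic (fun θ => ∫⁻ r in Ioo (0 : ℝ) 1,
      ENNReal.ofReal r * g (r * circlePt θ)) (2 * π) := by
    intro θ
    simp only [circlePt_periodic θ]
  have := lintegral_Ioc_periodic hper (-π) 0
  rw [zero_add, show -π + 2 * π = π by ring] at this
  exact this

theorem circlePt_arg {ζ : ℂ} (h : ‖ζ‖ = 1) : circlePt (Complex.arg ζ) = ζ := by
  simpa [circlePt, h] using Complex.norm_mul_exp_arg_mul_I ζ

theorem exists_circlePt_eq {ζ : ℂ} (h : ζ ∈ unitCircleSet) :
    ∃ θ ∈ Ioc (0 : ℝ) (2 * π), circlePt θ = ζ := by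
  have h1 : ‖ζ‖ = 1 := by simpa [unitCircleSet] using h
  obtain ⟨y, hy, hxy⟩ := circlePt_periodic.exists_mem_Ioc Real.two_pi_pos (Complex.arg ζ) 0
  exact ⟨y, by simpa using hy, by rw [← hxy, circlePt_arg h1]⟩

theorem volume_le_hausdorffMeasure_image_circlePt {T : Set ℝ}
    (hT : ∀ x ∈ T, ∀ y ∈ T, |x - y| ≤ π) :
    volume T ≤ ENNReal.ofReal (π / 2) * μH[1] (circlePt '' T) := by
  have hanti : ∀ x ∈ T, ∀ y ∈ T, |x - y| ≤ π / 2 * ‖circlePt x - circlePt y‖ := by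
    intro x hx y hy
    have := le_norm_circlePt_sub (hT x hx y hy)
    have hpi := Real.pi_pos
    calc |x - y| = π / 2 * (2 / π * |x - y|) := by field_simp
      _ ≤ _ := by gcongr
  have hinj : InjOn circlePt T := by
    intro x hx y hy hxy
    have := hanti x hx y hy
    rw [hxy, sub_self, norm_zero, mul_zero] at this
    exact sub_eq_zero.1 (abs_nonpos_iff.1 this)
  have hlip : LipschitzOnWith (Real.toNNReal (π / 2)) (Function.invFunOn circlePt T)
      (circlePt '' T) := by
    refine LipschitzOnWith.of_dist_le_mul ?_
    rintro _ ⟨x, hx, rfl⟩ _ ⟨y, hy, rfl⟩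
    rw [hinj.leftInvOn_invFunOn hx, hinj.leftInvOn_invFunOn hy, Real.coe_toNNReal _ (by positivity),
      Real.dist_eq, dist_eq_norm]
    exact hanti x hx y hy
  have := hlip.hausdorffMeasure_image_le zero_le_one
  rw [hinj.leftInvOn_invFunOn.image_image, hausdorffMeasure_real] at this
  simpa [ENNReal.ofReal] using this

/-- Null sets of arc length on the circle are the null sets in the angle parameter. -/
theorem ae_unitCircle_iff {P : ℂ → Prop} :
    (∀ᵐ ζ ∂(μH[1] : Measure ℂ).restrict unitCircleSet, P ζ) ↔
      ∀ᵐ θ ∂volume.restrict (Ioc (0 : ℝ) (2 * π)), P (circlePt θ) := by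
  rw [ae_restrict_iff' (show MeasurableSet unitCircleSet from isClosed_sphere.measurableSet),
    ae_restrict_iff' measurableSet_Ioc, ae_iff, ae_iff]
  constructor
  · intro h
    set N := {a | ¬(a ∈ unitCircleSet → P a)}
    have key : ∀ a : ℝ, volume (Icc a (a + π) ∩ circlePt ⁻¹' N) = 0 := by
      intro a
      refine le_antisymm ?_ bot_le
      refine (volume_le_hausdorffMeasure_image_circlePt ?_).trans ?_
      · rintro x ⟨⟨h1, h2⟩, -⟩ y ⟨⟨h3, h4⟩, -⟩
        rw [abs_le]; constructor <;> linarith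
      · rw [measure_mono_null (t := N) (by rintro _ ⟨x, ⟨-, hx⟩, rfl⟩; exact hx) h, mul_zero]
    refine measure_mono_null ?_ (measure_union_null (key 0) (key π))
    intro x hx
    have hx' : (x ∈ Ioc 0 (2 * π)) ∧ ¬ P (circlePt x) := by simpa [and_assoc] using hx
    obtain ⟨⟨h1, h2⟩, h3⟩ := hx'
    have hN : circlePt x ∈ N := by simp [N, unitCircleSet, h3]
    rcases le_total x π with h4 | h4
    · exact Or.inl ⟨⟨h1.le, by linarith⟩, hN⟩
    · exact Or.inr ⟨⟨h4, by linarith⟩, hN⟩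
  · intro h
    refine measure_mono_null (t := circlePt '' {a | ¬(a ∈ Ioc 0 (2 * π) → P (circlePt a))}) ?_ ?_
    · intro ζ hζ
      have hζ' : ζ ∈ unitCircleSet ∧ ¬ P ζ := by simpa using hζ
      obtain ⟨θ, hθ, rfl⟩ := exists_circlePt_eq hζ'.1
      refine ⟨θ, ?_, rfl⟩
      simpa [and_assoc] using And.intro hθ hζ'.2
    · refine le_antisymm ?_ bot_le
      refine (lipschitzWith_circlePt.hausdorffMeasure_image_le zero_le_one _).trans ?_
      rw [hausdorffMeasure_real, h, mul_zero]

theorem frontier_unitDiskSet : frontier unitDiskSet = unitCircleSet := by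
  simp [unitDiskSet, unitCircleSet, frontier_ball]

theorem infDist_unitCircle_le {z : ℂ} (hz : z ∈ unitDiskSet) :
    infDist z (frontier unitDiskSet) ≤ 1 - ‖z‖ := by
  have hz1 : ‖z‖ < 1 := by simpa [unitDiskSet] using hz
  rw [frontier_unitDiskSet]
  have h := infDist_le_dist_of_mem (x := z) (s := unitCircleSet) (y := circlePt (Complex.arg z))
    (by simp [unitCircleSet])
  refine h.trans (le_of_eq ?_)
  have hz2 : z = ‖z‖ * circlePt (Complex.arg z) := (Complex.norm_mul_exp_arg_mul_I z).symm
  have h3 : z - circlePt (Complex.arg z) = ((‖z‖ - 1 : ℝ) : ℂ) * circlePt (Complex.arg z) := by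
    push_cast
    rw [sub_mul, one_mul, ← hz2]
  rw [dist_eq_norm, h3, norm_mul, norm_circlePt, mul_one, Complex.norm_real, Real.norm_eq_abs,
    abs_of_nonpos (by linarith)]
  ring

theorem le_infDist_unitCircle (z : ℂ) : 1 - ‖z‖ ≤ infDist z (frontier unitDiskSet) := by
  rw [frontier_unitDiskSet]
  refine (le_infDist ⟨1, by simp [unitCircleSet]⟩).2 fun y hy => ?_
  have hy1 : ‖y‖ = 1 := by simpa [unitCircleSet] using hy
  rw [dist_comm, dist_eq_norm, ← hy1]
  exact norm_sub_norm_le _ _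

theorem norm_real_mul_circlePt {r : ℝ} (hr : 0 ≤ r) (θ : ℝ) : ‖(r : ℂ) * circlePt θ‖ = r := by
  rw [norm_mul, norm_circlePt, mul_one, Complex.norm_real, Real.norm_of_nonneg hr]

theorem real_mul_circlePt_mem {r : ℝ} (hr : 0 ≤ r) (h1 : r < 1) (θ : ℝ) :
    (r : ℂ) * circlePt θ ∈ unitDiskSet := by
  simpa [unitDiskSet, abs_of_nonneg hr] using h1

/-- A nontangential limit is in particular a radial limit. -/
theorem HasNTLimAt.tendsto_radial {f : ℂ → ℂ} {L : ℂ} {θ : ℝ}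
    (h : HasNTLimAt f unitDiskSet L (circlePt θ)) :
    Tendsto (fun s : ℝ => f (((1 - s : ℝ) : ℂ) * circlePt θ)) (𝓝[>] 0) (𝓝 L) := by
  refine (h 2 one_lt_two).comp (tendsto_nhdsWithin_iff.2 ⟨?_, ?_⟩)
  · have : Tendsto (fun s : ℝ => ((1 - s : ℝ) : ℂ) * circlePt θ) (𝓝 0)
        (𝓝 (((1 - 0 : ℝ) : ℂ) * circlePt θ)) := by
      apply Continuous.tendsto
      fun_prop
    simpa using this.mono_left nhdsWithin_le_nhds
  · filter_upwards [Ioo_mem_nhdsGT (zero_lt_one (α := ℝ))] with s hs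
    refine ⟨real_mul_circlePt_mem (by linarith [hs.2]) (by linarith [hs.1]) _, ?_⟩
    have h1 := le_infDist_unitCircle (((1 - s : ℝ) : ℂ) * circlePt θ)
    rw [norm_real_mul_circlePt (by linarith [hs.2])] at h1
    have h2 : ((1 - s : ℝ) : ℂ) * circlePt θ - circlePt θ = ((-s : ℝ) : ℂ) * circlePt θ := by
      push_cast; ring
    rw [h2, norm_mul, norm_circlePt, Complex.norm_real, norm_neg, Real.norm_of_nonneg hs.1.le]
    linarith [hs.1]

theorem isNTBoundaryFun_unitDisk_iff {f φ : ℂ → ℂ} :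
    IsNTBoundaryFun f unitDiskSet unitCircleSet φ ↔
      ∀ᵐ θ ∂volume.restrict (Ioc (0 : ℝ) (2 * π)),
        HasNTLimAt f unitDiskSet (φ (circlePt θ)) (circlePt θ) :=
  ae_unitCircle_iff

theorem isOpen_unitDiskSet : IsOpen unitDiskSet := isOpen_ball

theorem laplacian_eq_fderiv_fderiv {f : ℂ → ℂ} {z : ℂ} (hf : ContDiffAt ℝ 2 f z) :
    Laplacian.laplacian f z = fderiv ℝ (fun w => fderiv ℝ f w 1) z 1 +
      fderiv ℝ (fun w => fderiv ℝ f w Complex.I) z Complex.I := by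
  have hd : DifferentiableAt ℝ (fderiv ℝ f) z :=
    (hf.fderiv_right (m := 1) (by norm_num)).differentiableAt one_ne_zero
  have h : ∀ v : ℂ, fderiv ℝ (fun w => fderiv ℝ f w v) z v = fderiv ℝ (fderiv ℝ f) z v v := by
    intro v
    rw [fderiv_clm_apply hd (differentiableAt_const v)]
    simp
  rw [h, h, InnerProductSpace.laplacian_eq_iteratedFDeriv_complexPlane]
  simp [iteratedFDeriv_two_apply]

theorem isHarmonicOn_iff {f : ℂ → ℂ} {Ω : Set ℂ} (hΩ : IsOpen Ω) :
    IsHarmonicOn f Ω ↔ InnerProductSpace.HarmonicOnNhd f Ω := by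
  constructor
  · rintro ⟨h1, h2⟩ z hz
    refine ⟨h1.contDiffAt (hΩ.mem_nhds hz), ?_⟩
    filter_upwards [hΩ.mem_nhds hz] with w hw
    rw [laplacian_eq_fderiv_fderiv (h1.contDiffAt (hΩ.mem_nhds hw)), h2 w hw]
    rfl
  · intro h
    refine ⟨h.contDiffOn, fun z hz => ?_⟩
    rw [← laplacian_eq_fderiv_fderiv (h z hz).1]
    exact (h z hz).2.self_of_nhds

/-- The Herglotz integral of a function of the angle. -/
def herglotz (u : ℝ → ℂ) (z : ℂ) : ℂ :=
  (2 * π)⁻¹ • ∫ θ in Ioc (0 : ℝ) (2 * π), (circlePt θ + z) / (circlePt θ - z) * u θ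

theorem one_sub_norm_le (z : ℂ) (θ : ℝ) : 1 - ‖z‖ ≤ ‖circlePt θ - z‖ := by
  simpa using norm_sub_norm_le (circlePt θ) z

theorem circlePt_sub_ne_zero {z : ℂ} (hz : z ∈ unitDiskSet) (θ : ℝ) : circlePt θ - z ≠ 0 := by
  have hz1 : ‖z‖ < 1 := by simpa [unitDiskSet] using hz
  rw [← norm_pos_iff]
  linarith [one_sub_norm_le z θ]

theorem integrableOn_bdd_mul {u : ℝ → ℂ} (hu : IntegrableOn u (Ioc 0 (2 * π)))
    {k : ℝ → ℂ} (hk : Continuous k) :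
    IntegrableOn (fun θ => k θ * u θ) (Ioc 0 (2 * π)) := by
  obtain ⟨C, hC⟩ := isCompact_Icc.exists_bound_of_continuousOn
    (hk.continuousOn (s := Icc 0 (2 * π)))
  refine Integrable.bdd_mul (c := C) hu hk.aestronglyMeasurable ?_
  filter_upwards [ae_restrict_mem measurableSet_Ioc] with θ hθ
  exact hC θ (Ioc_subset_Icc_self hθ)

theorem continuous_herglotz_kernel {z : ℂ} (hz : z ∈ unitDiskSet) :
    Continuous fun θ => (circlePt θ + z) / (circlePt θ - z) :=
  Continuous.div (by fun_prop) (by fun_prop) (circlePt_sub_ne_zero hz)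

theorem hasDerivAt_herglotz {u : ℝ → ℂ} (hu : IntegrableOn u (Ioc 0 (2 * π))) {z : ℂ}
    (hz : z ∈ unitDiskSet) :
    HasDerivAt (herglotz u) ((2 * π)⁻¹ • ∫ θ in Ioc (0 : ℝ) (2 * π),
      2 * circlePt θ / (circlePt θ - z) ^ 2 * u θ) z := by
  have hz1 : ‖z‖ < 1 := by simpa [unitDiskSet] using hz
  set ε := (1 - ‖z‖) / 2 with hε
  have hεp : 0 < ε := by simp only [hε]; linarith
  have hball : ∀ w ∈ ball z ε, ‖w‖ + ε ≤ 1 := by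
    intro w hw
    have h1 : ‖w - z‖ < ε := by simpa [dist_eq_norm] using hw
    have h2 := norm_sub_norm_le w z
    simp only [hε] at *
    linarith
  have hmem : ∀ w ∈ ball z ε, w ∈ unitDiskSet := fun w hw => by
    have := hball w hw
    simpa [unitDiskSet] using by linarith
  refine HasDerivAt.const_smul ((2 * π)⁻¹ : ℝ) ?_
  refine (hasDerivAt_integral_of_dominated_loc_of_deriv_le
    (F := fun w θ => (circlePt θ + w) / (circlePt θ - w) * u θ)
    (F' := fun w θ => 2 * circlePt θ / (circlePt θ - w) ^ 2 * u θ)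
    (bound := fun θ => 2 / ε ^ 2 * ‖u θ‖) (s := ball z ε) (ball_mem_nhds _ hεp) ?_ ?_ ?_ ?_ ?_ ?_).2
  · filter_upwards [ball_mem_nhds z hεp] with w hw
    exact (integrableOn_bdd_mul hu (continuous_herglotz_kernel (hmem w hw))).aestronglyMeasurable
  · exact integrableOn_bdd_mul hu (continuous_herglotz_kernel hz)
  · refine (integrableOn_bdd_mul hu (Continuous.div (by fun_prop) (by fun_prop) fun θ => ?_)).aestronglyMeasurable
    exact pow_ne_zero _ (circlePt_sub_ne_zero hz θ)
  · refine Eventually.of_forall fun θ w hw => ?_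
    rw [norm_mul, norm_div, norm_mul, norm_circlePt, norm_pow, mul_one]
    have h1 : ε ≤ ‖circlePt θ - w‖ := by linarith [one_sub_norm_le w θ, hball w hw]
    simp only [Complex.norm_ofNat]
    gcongr
  · exact (Integrable.norm hu).const_mul _
  · refine Eventually.of_forall fun θ w hw => ?_
    have hne := circlePt_sub_ne_zero (hmem w hw) θ
    have h1 : HasDerivAt (fun w => (circlePt θ + w) / (circlePt θ - w))
        ((1 * (circlePt θ - w) - (circlePt θ + w) * (-1)) / (circlePt θ - w) ^ 2) w :=
      ((hasDerivAt_id w).const_add _).div ((hasDerivAt_id w).const_sub _) hne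
    refine (h1.mul_const (u θ)).congr_deriv ?_
    congr 2
    ring

theorem poisson_kernel_eq {z : ℂ} (θ : ℝ) :
    (((1 - ‖z‖ ^ 2) / ‖circlePt θ - z‖ ^ 2 : ℝ) : ℂ) =
      ((circlePt θ + z) / (circlePt θ - z) + conj ((circlePt θ + z) / (circlePt θ - z))) / 2 := by
  have h := congrFun (poissonKernel_eq_re_herglotzRieszKernel (c := 0) (w := z)) (circlePt θ)
  simp only [poissonKernel, herglotzRieszKernel, sub_zero, norm_circlePt, one_pow,
    Function.comp_apply] at h
  rw [h, Complex.re_eq_add_conj]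

theorem poissonDisk_eq_herglotz {φ : ℂ → ℂ}
    (hφ : IntegrableOn (fun θ : ℝ => φ (circlePt θ)) (Ioc 0 (2 * π))) {z : ℂ}
    (hz : z ∈ unitDiskSet) :
    poissonDisk φ z = (herglotz (fun θ => φ (circlePt θ)) z +
      conj (herglotz (fun θ => conj (φ (circlePt θ))) z)) / 2 := by
  have hconj : IntegrableOn (fun θ : ℝ => conj (φ (circlePt θ))) (Ioc 0 (2 * π)) :=
    (Complex.conjCLE.toContinuousLinearMap.integrable_comp hφ)
  have hk := continuous_herglotz_kernel hz
  have hkc : Continuous fun θ => conj ((circlePt θ + z) / (circlePt θ - z)) :=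
    Complex.continuous_conj.comp hk
  have h1 := integrableOn_bdd_mul hφ hk
  have h2 := integrableOn_bdd_mul hφ hkc
  simp only [poissonDisk, herglotz, Complex.real_smul, map_mul, Complex.conj_ofReal]
  rw [← integral_conj]
  simp only [map_mul, Complex.conj_conj]
  rw [← mul_add, ← integral_add h1 h2, mul_div_assoc, ← integral_div]
  congr 1
  refine integral_congr_ae (Eventually.of_forall fun θ => ?_)
  simp only [poisson_kernel_eq]
  ring

theorem analyticAt_herglotz {u : ℝ → ℂ} (hu : IntegrableOn u (Ioc 0 (2 * π))) {z : ℂ}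
    (hz : z ∈ unitDiskSet) : AnalyticAt ℂ (herglotz u) z :=
  DifferentiableOn.analyticAt (s := unitDiskSet)
    (fun _ hw => (hasDerivAt_herglotz hu hw).differentiableAt.differentiableWithinAt)
    (isOpen_unitDiskSet.mem_nhds hz)

theorem isHarmonicOn_poissonDisk {φ : ℂ → ℂ}
    (hφ : IntegrableOn (fun θ : ℝ => φ (circlePt θ)) (Ioc 0 (2 * π))) :
    IsHarmonicOn (poissonDisk φ) unitDiskSet := by
  rw [isHarmonicOn_iff isOpen_unitDiskSet]
  intro z hz
  have hconj : IntegrableOn (fun θ : ℝ => conj (φ (circlePt θ))) (Ioc 0 (2 * π)) :=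
    (Complex.conjCLE.toContinuousLinearMap.integrable_comp hφ)
  have h := (((analyticAt_herglotz hφ hz).harmonicAt).add
    (analyticAt_herglotz hconj hz).harmonicAt_conj).const_smul (c := (1 / 2 : ℝ))
  refine (InnerProductSpace.harmonicAt_congr_nhds ?_).2 h
  filter_upwards [isOpen_unitDiskSet.mem_nhds hz] with w hw
  rw [poissonDisk_eq_herglotz hφ hw]
  simp
  ring

theorem integrableOn_poisson {u : ℝ → ℂ} (hu : IntegrableOn u (Ioc 0 (2 * π))) {z : ℂ}
    (hz : z ∈ unitDiskSet) :
    IntegrableOn (fun θ => ((1 - ‖z‖ ^ 2) / ‖circlePt θ - z‖ ^ 2) • u θ) (Ioc 0 (2 * π)) := by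
  simp only [Complex.real_smul]
  refine integrableOn_bdd_mul hu (Complex.continuous_ofReal.comp (Continuous.div (by fun_prop) (by fun_prop) fun θ => ?_))
  exact pow_ne_zero _ (norm_ne_zero_iff.2 (circlePt_sub_ne_zero hz θ))

theorem circleAverage_poissonKernel_zero {g : ℂ → ℝ} {r : ℝ} (h0 : 0 ≤ r) {z : ℂ} :
    Real.circleAverage (poissonKernel 0 z • g) 0 r = (2 * π)⁻¹ * ∫ θ in Ioc (0 : ℝ) (2 * π),
      ((r ^ 2 - ‖z‖ ^ 2) / ‖r * circlePt θ - z‖ ^ 2) * g (r * circlePt θ) := by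
  rw [Real.circleAverage_def, intervalIntegral.integral_of_le Real.two_pi_pos.le, smul_eq_mul]
  congr 1
  refine integral_congr_ae (Eventually.of_forall fun θ => ?_)
  have hc : circleMap 0 r θ = r * circlePt θ := by simp [circleMap, circlePt]
  simp [poissonKernel, hc, abs_of_nonneg h0]

theorem continuousOn_of_isHarmonicOn {Φ : ℂ → ℂ} {Ω : Set ℂ} (hΦ : IsHarmonicOn Φ Ω) :
    ContinuousOn Φ Ω := hΦ.1.continuousOn

theorem continuous_comp_circlePt {Φ : ℂ → ℂ} (hΦ : ContinuousOn Φ unitDiskSet) {r : ℝ}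
    (h0 : 0 ≤ r) (h1 : r < 1) : Continuous fun θ => Φ (r * circlePt θ) :=
  hΦ.comp_continuous (by fun_prop) fun θ => real_mul_circlePt_mem h0 h1 θ

/-- The Poisson integral formula on a concentric circle. -/
theorem poisson_formula {Φ : ℂ → ℂ} (hΦ : IsHarmonicOn Φ unitDiskSet) {r : ℝ}
    (h1 : r < 1) {z : ℂ} (hz : ‖z‖ < r) :
    (2 * π)⁻¹ • ∫ θ in Ioc (0 : ℝ) (2 * π),
      ((r ^ 2 - ‖z‖ ^ 2) / ‖r * circlePt θ - z‖ ^ 2) • Φ (r * circlePt θ) = Φ z := by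
  have h0 : 0 ≤ r := (norm_nonneg z).trans hz.le
  have hh : InnerProductSpace.HarmonicOnNhd Φ (closedBall 0 r) :=
    ((isHarmonicOn_iff isOpen_unitDiskSet).1 hΦ).mono (closedBall_subset_ball h1)
  have hzr : z ∈ ball (0 : ℂ) r := by simpa using hz
  have hint : IntegrableOn (fun θ => ((r ^ 2 - ‖z‖ ^ 2) / ‖r * circlePt θ - z‖ ^ 2) •
      Φ (r * circlePt θ)) (Ioc 0 (2 * π)) := by
    refine (Continuous.integrableOn_Icc ?_).mono_set Ioc_subset_Icc_self
    have hc : Continuous fun θ => ‖r * circlePt θ - z‖ ^ 2 := by fun_prop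
    refine Continuous.smul (continuous_const.div hc fun θ => ?_)
      (continuous_comp_circlePt (continuousOn_of_isHarmonicOn hΦ) h0 h1)
    refine pow_ne_zero _ (norm_ne_zero_iff.2 fun h => hz.ne ?_)
    rw [← sub_eq_zero.1 h, norm_real_mul_circlePt h0]
  have hre := (hh.comp_CLM Complex.reCLM).circleAverage_poissonKernel_smul hzr
  have him := (hh.comp_CLM Complex.imCLM).circleAverage_poissonKernel_smul hzr
  rw [circleAverage_poissonKernel_zero h0] at hre him
  refine Complex.ext ?_ ?_
  · rw [Complex.smul_re, smul_eq_mul]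
    refine Eq.trans ?_ hre
    congr 1
    refine (Complex.reCLM.integral_comp_comm hint).symm.trans ?_
    simp only [Complex.reCLM_apply, Complex.smul_re, smul_eq_mul, Function.comp_apply]
  · rw [Complex.smul_im, smul_eq_mul]
    refine Eq.trans ?_ him
    congr 1
    refine (Complex.imCLM.integral_comp_comm hint).symm.trans ?_
    simp only [Complex.imCLM_apply, Complex.smul_im, smul_eq_mul, Function.comp_apply]

theorem integral_poisson_kernel {z : ℂ} (hz : z ∈ unitDiskSet) :
    (2 * π)⁻¹ • ∫ θ in Ioc (0 : ℝ) (2 * π), ((1 - ‖z‖ ^ 2) / ‖circlePt θ - z‖ ^ 2) = 1 := by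
  have h : InnerProductSpace.HarmonicOnNhd (fun _ : ℂ => (1 : ℝ)) (closedBall 0 1) :=
    fun _ _ => ⟨contDiffAt_const, by simp⟩
  have h := h.circleAverage_poissonKernel_smul (w := z) hz
  rw [circleAverage_poissonKernel_zero zero_le_one] at h
  simpa using h

theorem poissonDisk_sub_const {φ : ℂ → ℂ}
    (hφ : IntegrableOn (fun θ : ℝ => φ (circlePt θ)) (Ioc 0 (2 * π))) {z : ℂ}
    (hz : z ∈ unitDiskSet) (c : ℂ) :
    poissonDisk (fun ζ => φ ζ - c) z = poissonDisk φ z - c := by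
  have hc : IntegrableOn (fun _ : ℝ => c) (Ioc 0 (2 * π)) :=
    integrableOn_const measure_Ioc_lt_top.ne
  simp only [poissonDisk, smul_sub]
  rw [integral_sub (integrableOn_poisson hφ hz) (integrableOn_poisson hc hz), smul_sub,
    integral_smul_const, ← smul_assoc, integral_poisson_kernel hz, one_smul]

theorem norm_deriv_herglotz_le {u : ℝ → ℂ} (hu : IntegrableOn u (Ioc 0 (2 * π))) {z : ℂ}
    (hz : z ∈ unitDiskSet) :
    ‖deriv (herglotz u) z‖ ≤ π⁻¹ * ∫ θ in Ioc (0 : ℝ) (2 * π), ‖u θ‖ * ‖circlePt θ - z‖ ^ (-2 : ℝ) := by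
  rw [(hasDerivAt_herglotz hu hz).deriv, norm_smul]
  have h1 : ‖∫ θ in Ioc (0 : ℝ) (2 * π), 2 * circlePt θ / (circlePt θ - z) ^ 2 * u θ‖ ≤
      ∫ θ in Ioc (0 : ℝ) (2 * π), 2 * (‖u θ‖ * ‖circlePt θ - z‖ ^ (-2 : ℝ)) := by
    refine (norm_integral_le_integral_norm _).trans (le_of_eq ?_)
    refine integral_congr_ae (Eventually.of_forall fun θ => ?_)
    simp only [norm_mul, norm_div, norm_pow, norm_circlePt, Complex.norm_ofNat,
      Real.rpow_neg (norm_nonneg _), Real.rpow_two]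
    ring
  rw [integral_const_mul] at h1
  rw [Real.norm_of_nonneg (by positivity)]
  refine (mul_le_mul_of_nonneg_left h1 (by positivity)).trans (le_of_eq ?_)
  rw [mul_inv]
  ring

theorem gradNorm_poissonDisk_le {φ : ℂ → ℂ}
    (hφ : IntegrableOn (fun θ : ℝ => φ (circlePt θ)) (Ioc 0 (2 * π))) {z : ℂ}
    (hz : z ∈ unitDiskSet) (c : ℂ) :
    ENNReal.ofReal (gradNorm (poissonDisk φ) z) ≤ ∫⁻ θ in Ioc (0 : ℝ) (2 * π),
      ‖φ (circlePt θ) - c‖ₑ * ENNReal.ofReal (‖circlePt θ - z‖ ^ (-2 : ℝ)) := by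
  set u : ℝ → ℂ := fun θ => φ (circlePt θ) - c with hu_def
  have hu : IntegrableOn u (Ioc 0 (2 * π)) := hφ.sub (integrableOn_const measure_Ioc_lt_top.ne)
  have hconj : IntegrableOn (fun θ : ℝ => conj (u θ)) (Ioc 0 (2 * π)) :=
    (Complex.conjCLE.toContinuousLinearMap.integrable_comp hu)
  set J := ∫ θ in Ioc (0 : ℝ) (2 * π), ‖u θ‖ * ‖circlePt θ - z‖ ^ (-2 : ℝ) with hJ
  have hJ0 : 0 ≤ J := integral_nonneg fun θ => by positivity
  have hF := (hasDerivAt_herglotz hu hz).differentiableAt.hasDerivAt.complexToReal_fderiv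
  have hG := (hasDerivAt_herglotz hconj hz).differentiableAt.hasDerivAt.complexToReal_fderiv
  have hFn := norm_deriv_herglotz_le hu hz
  have hGn := norm_deriv_herglotz_le hconj hz
  simp only [RCLike.norm_conj] at hGn
  rw [← hJ] at hFn hGn
  have hev : poissonDisk φ =ᶠ[𝓝 z] fun w =>
      (1 / 2 : ℝ) • (herglotz u w + conj (herglotz (fun θ => conj (u θ)) w)) + c := by
    filter_upwards [isOpen_unitDiskSet.mem_nhds hz] with w hw
    rw [← sub_eq_iff_eq_add, ← poissonDisk_sub_const hφ hw c, poissonDisk_eq_herglotz hu hw]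
    simp only [Complex.real_smul]
    push_cast
    ring
  have hfd : ∀ v : ℂ, ‖fderiv ℝ (poissonDisk φ) z v‖ ≤ π⁻¹ * J * ‖v‖ := by
    intro v
    have hG' := Complex.conjCLE.hasFDerivAt.comp z hG
    have hD : HasFDerivAt (fun w =>
        (1 / 2 : ℝ) • (herglotz u w + conj (herglotz (fun θ => conj (u θ)) w)) + c) _ z :=
      ((hF.add hG').const_smul (1 / 2 : ℝ)).add_const c
    rw [hev.fderiv_eq, hD.fderiv]
    have e1 : ‖deriv (herglotz u) z * v‖ ≤ π⁻¹ * J * ‖v‖ := by rw [norm_mul]; gcongr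
    have e2 : ‖conj (deriv (herglotz fun θ => conj (u θ)) z * v)‖ ≤ π⁻¹ * J * ‖v‖ := by
      rw [RCLike.norm_conj, norm_mul]; gcongr
    have e3 := norm_add_le (deriv (herglotz u) z * v)
      (conj (deriv (herglotz fun θ => conj (u θ)) z * v))
    simp only [smul_apply, add_apply, norm_smul]
    simp only [map_mul] at e2 e3
    simp
    linarith
  have hg : gradNorm (poissonDisk φ) z ≤ J := by
    have e1 := hfd 1
    have e2 := hfd Complex.I
    simp only [norm_one, Complex.norm_I, mul_one] at e1 e2
    have e3 : π⁻¹ * J ≤ 2⁻¹ * J := by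
      have := Real.two_le_pi
      gcongr
    rw [gradNorm]
    refine Real.sqrt_le_iff.2 ⟨hJ0, ?_⟩
    have := pow_le_pow_left₀ (norm_nonneg _) (e1.trans e3) 2
    have := pow_le_pow_left₀ (norm_nonneg _) (e2.trans e3) 2
    nlinarith [sq_nonneg J]
  refine (ENNReal.ofReal_le_ofReal hg).trans (le_of_eq ?_)
  rw [hJ, ofReal_integral_eq_lintegral_ofReal]
  · refine lintegral_congr fun θ => ?_
    rw [ENNReal.ofReal_mul (norm_nonneg _), ofReal_norm]
  · have hk : Continuous fun θ : ℝ => ((‖circlePt θ - z‖ ^ (-2 : ℝ) : ℝ) : ℂ) :=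
      Complex.continuous_ofReal.comp (Continuous.rpow_const (by fun_prop)
        fun θ => Or.inl (norm_ne_zero_iff.2 (circlePt_sub_ne_zero hz θ)))
    refine (Integrable.norm (integrableOn_bdd_mul hu hk)).congr (Eventually.of_forall fun θ => ?_)
    simp only [norm_mul, Complex.norm_real]
    rw [Real.norm_of_nonneg (by positivity), mul_comm]
  · exact Eventually.of_forall fun θ => by positivity

theorem lintegral_Ioo_deriv {G G' : ℝ → ℝ} {a b : ℝ} (hab : a ≤ b)
    (hc : ContinuousOn G (Icc a b)) (hd : ∀ x ∈ Ioo a b, HasDerivAt G (G' x) x)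
    (hpos : ∀ x ∈ Ioo a b, 0 ≤ G' x) :
    ∫⁻ x in Ioo a b, ENNReal.ofReal (G' x) = ENNReal.ofReal (G b - G a) := by
  have hint : IntegrableOn G' (Ioc a b) :=
    intervalIntegral.integrableOn_deriv_of_nonneg hc hd hpos
  have h1 := intervalIntegral.integral_eq_sub_of_hasDerivAt_of_le hab hc hd
    ((intervalIntegrable_iff_integrableOn_Ioc_of_le hab).2 hint)
  rw [← h1, intervalIntegral.integral_of_le hab, ← restrict_Ioo_eq_restrict_Ioc,
    ofReal_integral_eq_lintegral_ofReal]
  · rw [restrict_Ioo_eq_restrict_Ioc]; exact hint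
  · filter_upwards [ae_restrict_mem measurableSet_Ioo] with x hx using hpos x hx

/-- Hölder's inequality raised to the power `p`. -/
theorem lintegral_mul_rpow_le {α : Type*} [MeasurableSpace α] (μ : Measure α) {p : ℝ} (hp : 1 < p)
    {f g : α → ℝ≥0∞} (hf : AEMeasurable f μ) (hg : AEMeasurable g μ) :
    (∫⁻ x, f x * g x ∂μ) ^ p ≤ (∫⁻ x, f x ^ p ∂μ) * (∫⁻ x, g x ^ (p / (p - 1)) ∂μ) ^ (p - 1) := by
  have hp0 : 0 < p := by linarith
  have h := ENNReal.lintegral_mul_le_Lp_mul_Lq μ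
    (Real.HolderConjugate.conjExponent hp) hf hg
  refine (ENNReal.rpow_le_rpow h hp0.le).trans (le_of_eq ?_)
  rw [ENNReal.mul_rpow_of_nonneg _ _ hp0.le, ← ENNReal.rpow_mul, ← ENNReal.rpow_mul]
  have e : 1 / Real.conjExponent p * p = p - 1 := by
    rw [Real.conjExponent]; field_simp
  rw [e, one_div_mul_cancel hp0.ne', ENNReal.rpow_one]
  rfl

theorem lintegral_comp_abs_le {F : ℝ → ℝ≥0∞} (a : ℝ) :
    ∫⁻ t in Ioc (-a) a, F |t| ≤ 2 * ∫⁻ t in Ioc 0 a, F t := by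
  have h0 : ∫⁻ t in Ioc 0 a, F |t| = ∫⁻ t in Ioc 0 a, F t :=
    setLIntegral_congr_fun measurableSet_Ioc fun t ht => by simp only [abs_of_pos ht.1]
  have h1 : ∫⁻ t in Ico (-a) 0, F |t| = ∫⁻ t in Ioc 0 a, F t := by
    have := (Measure.measurePreserving_neg (volume : Measure ℝ)).setLIntegral_comp_emb
      (MeasurableEquiv.neg ℝ).measurableEmbedding (fun t => F |t|) (Ico (-a) 0)
    simp only [abs_neg] at this
    rw [this, ← h0]
    simp
  calc ∫⁻ t in Ioc (-a) a, F |t| ≤ ∫⁻ t in Icc (-a) 0 ∪ Ioc 0 a, F |t| := by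
        refine lintegral_mono_set fun t ht => ?_
        rcases le_or_gt t 0 with h | h
        · exact Or.inl ⟨ht.1.le, h⟩
        · exact Or.inr ⟨h, ht.2⟩
    _ ≤ (∫⁻ t in Icc (-a) 0, F |t|) + ∫⁻ t in Ioc 0 a, F |t| := lintegral_union_le _ _ _
    _ = 2 * ∫⁻ t in Ioc 0 a, F t := by
        rw [← restrict_Ico_eq_restrict_Icc, h0, h1, two_mul]

theorem norm_circlePt_sub_real_mul {r : ℝ} (h0 : 0 ≤ r) (h1 : r ≤ 1) (x y : ℝ) :
    ((1 - r) + ‖circlePt y - circlePt x‖) / 3 ≤ ‖circlePt y - r * circlePt x‖ := by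
  have e1 := one_sub_norm_le (r * circlePt x) y
  rw [norm_real_mul_circlePt h0] at e1
  have e2 : ‖r * circlePt x - circlePt x‖ = 1 - r := by
    have : r * circlePt x - circlePt x = ((-(1 - r) : ℝ) : ℂ) * circlePt x := by
      push_cast; ring
    rw [this, norm_mul, norm_circlePt, mul_one, Complex.norm_real, norm_neg,
      Real.norm_of_nonneg (by linarith)]
  have e3 := norm_add_le (circlePt y - r * circlePt x) (r * circlePt x - circlePt x)
  rw [sub_add_sub_cancel, e2] at e3
  linarith

theorem lintegral_kernel_angle_le {r : ℝ} (h0 : 0 ≤ r) (h1 : r < 1) (x : ℝ) :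
    ∫⁻ θ in Ioc (0 : ℝ) (2 * π), ENNReal.ofReal (‖circlePt θ - r * circlePt x‖ ^ (-(3 / 2) : ℝ)) ≤
      ENNReal.ofReal (4 * 6 ^ (3 / 2 : ℝ) * (1 - r) ^ (-(1 / 2) : ℝ)) := by
  set δ := 1 - r with hδ
  have hδ0 : 0 < δ := by linarith
  have hper : Function.Periodic (fun θ => ENNReal.ofReal
      (‖circlePt θ - r * circlePt x‖ ^ (-(3 / 2) : ℝ))) (2 * π) := fun θ => by
    simp only [circlePt_periodic θ]
  rw [← zero_add (2 * π), ← lintegral_Ioc_periodic_add hper (-π) 0 x,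
    show -π + 2 * π = π by ring]
  have hle : ∀ t ∈ Ioc (-π) π, ENNReal.ofReal
      (‖circlePt (t + x) - r * circlePt x‖ ^ (-(3 / 2) : ℝ)) ≤
      ENNReal.ofReal (6 ^ (3 / 2 : ℝ) * (δ + |t|) ^ (-(3 / 2) : ℝ)) := by
    intro t ht
    refine ENNReal.ofReal_le_ofReal ?_
    have e1 := norm_circlePt_sub_real_mul h0 h1.le x (t + x)
    have e2 : 2 / π * |t| ≤ ‖circlePt (t + x) - circlePt x‖ := by
      simpa using le_norm_circlePt_sub (x := t + x) (y := x)
        (by rw [add_sub_cancel_right, abs_le]; exact ⟨ht.1.le, ht.2⟩)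
    have e3 : 1 / 2 * |t| ≤ 2 / π * |t| := by
      have : (1 / 2 : ℝ) ≤ 2 / π := by
        rw [div_le_div_iff₀ two_pos Real.pi_pos]; linarith [Real.pi_le_four]
      gcongr
    have e4 : (δ + |t|) / 6 ≤ ‖circlePt (t + x) - r * circlePt x‖ := by
      rw [← hδ] at e1; linarith
    have e5 : 0 < δ + |t| := by positivity
    refine (Real.rpow_le_rpow_of_nonpos (by positivity) e4 (by norm_num)).trans (le_of_eq ?_)
    rw [Real.div_rpow e5.le (by norm_num), Real.rpow_neg (by norm_num : (0:ℝ) ≤ 6), div_inv_eq_mul,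
      mul_comm]
  refine (setLIntegral_mono' measurableSet_Ioc hle).trans ?_
  refine (lintegral_comp_abs_le (F := fun t => ENNReal.ofReal
    (6 ^ (3 / 2 : ℝ) * (δ + t) ^ (-(3 / 2) : ℝ))) π).trans ?_
  have hne : ∀ t : ℝ, 0 ≤ t → δ + t ≠ 0 := fun t ht => by positivity
  rw [← restrict_Ioo_eq_restrict_Ioc, lintegral_Ioo_deriv
    (G := fun t => -(2 * 6 ^ (3 / 2 : ℝ)) * (δ + t) ^ (-(1 / 2) : ℝ)) Real.pi_pos.le]
  · rw [← ENNReal.ofReal_ofNat 2, ← ENNReal.ofReal_mul (by norm_num)]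
    refine ENNReal.ofReal_le_ofReal ?_
    have : 0 ≤ (6 : ℝ) ^ (3 / 2 : ℝ) * (δ + π) ^ (-(1 / 2) : ℝ) := by positivity
    rw [add_zero]
    linarith
  · refine ContinuousOn.mul continuousOn_const (ContinuousOn.rpow_const (by fun_prop) ?_)
    intro t ht
    exact Or.inl (hne t ht.1)
  · intro t ht
    have := (((hasDerivAt_id t).const_add δ).rpow_const (p := -(1 / 2))
      (Or.inl (hne t ht.1.le))).const_mul (-(2 * 6 ^ (3 / 2 : ℝ)))
    refine this.congr_deriv ?_
    norm_num
    ring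
  · intro t ht
    have : 0 ≤ δ + t := by linarith [ht.1]
    positivity

theorem lintegral_kernel_radial_aux {p t : ℝ} (hp : 1 < p) (ht : 0 < t) :
    ∫⁻ s in Ioo (0 : ℝ) 1, ENNReal.ofReal (s ^ ((p - 3) / 2) * (s + t) ^ (-((p + 3) / 2))) ≤
      ENNReal.ofReal (2 / (p - 1) * t ^ (-2 : ℝ)) := by
  have hle : ∀ s ∈ Ioo (0 : ℝ) 1, ENNReal.ofReal (s ^ ((p - 3) / 2) * (s + t) ^ (-((p + 3) / 2))) ≤
      ENNReal.ofReal (t⁻¹ * (s ^ ((p - 3) / 2) * (s + t) ^ (-((p + 1) / 2)))) := by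
    intro s hs
    refine ENNReal.ofReal_le_ofReal ?_
    have hs0 := hs.1
    have e : (s + t) ^ (-((p + 3) / 2)) = (s + t)⁻¹ * (s + t) ^ (-((p + 1) / 2)) := by
      rw [← Real.rpow_neg_one (s + t), ← Real.rpow_add (by positivity)]
      congr 1; ring
    have e2 : (s + t)⁻¹ ≤ t⁻¹ := by gcongr; linarith
    rw [e]
    calc _ = (s + t)⁻¹ * (s ^ ((p - 3) / 2) * (s + t) ^ (-((p + 1) / 2))) := by ring
      _ ≤ _ := by gcongr
  refine (setLIntegral_mono' measurableSet_Ioo hle).trans ?_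
  have hp1 : 0 < (p - 1) / 2 := by linarith
  have hb : ∀ s : ℝ, 0 ≤ s → s + t ≠ 0 := fun s hs => by positivity
  rw [lintegral_Ioo_deriv (G := fun s => 2 / (p - 1) * t ^ (-2 : ℝ) * (s / (s + t)) ^ ((p - 1) / 2))
    zero_le_one]
  · refine ENNReal.ofReal_le_ofReal ?_
    rw [zero_div, Real.zero_rpow hp1.ne', mul_zero, sub_zero]
    refine mul_le_of_le_one_right ?_ (Real.rpow_le_one (by positivity) ?_ hp1.le)
    · have : 0 < p - 1 := by linarith
      positivity
    · rw [div_le_one (by positivity)]; linarith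
  · refine ContinuousOn.mul continuousOn_const (ContinuousOn.rpow_const ?_ fun _ _ => Or.inr hp1.le)
    exact ContinuousOn.div (by fun_prop) (by fun_prop) fun s hs => hb s hs.1
  · intro s hs
    have hs0 := hs.1
    have h1 : HasDerivAt (fun s => s / (s + t)) ((1 * (s + t) - s * 1) / (s + t) ^ 2) s :=
      (hasDerivAt_id s).div ((hasDerivAt_id s).add_const t) (hb s hs.1.le)
    refine ((h1.rpow_const (p := (p - 1) / 2) (Or.inl (by positivity))).const_mul _).congr_deriv ?_
    have e1 : (s / (s + t)) ^ ((p - 1) / 2 - 1) = s ^ ((p - 3) / 2) * (s + t) ^ (-((p - 3) / 2)) := by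
      rw [show (p - 1) / 2 - 1 = (p - 3) / 2 by ring, Real.div_rpow hs0.le (by positivity),
        Real.rpow_neg (by positivity), div_eq_mul_inv]
    have e2 : (s + t) ^ (-((p + 1) / 2)) = (s + t) ^ (-((p - 3) / 2)) * ((s + t) ^ 2)⁻¹ := by
      rw [← Real.rpow_natCast (s + t) 2, ← Real.rpow_neg (by positivity),
        ← Real.rpow_add (by positivity)]
      congr 1; push_cast; ring
    have e3 : t ^ (-2 : ℝ) = (t ^ 2)⁻¹ := by
      rw [Real.rpow_neg ht.le, Real.rpow_two]
    rw [e1, e2, e3]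
    have : p - 1 ≠ 0 := by linarith
    have := hb s hs0.le
    field_simp
    ring
  · intro s hs
    have hs0 := hs.1
    positivity

theorem lintegral_kernel_radial_le {p : ℝ} (hp : 1 < p) {x y : ℝ} (hxy : circlePt y ≠ circlePt x) :
    ∫⁻ r in Ioo (0 : ℝ) 1, ENNReal.ofReal ((1 - r) ^ ((p - 3) / 2)) *
        ENNReal.ofReal (‖circlePt y - r * circlePt x‖ ^ (-((p + 3) / 2))) ≤
      ENNReal.ofReal (3 ^ ((p + 3) / 2) * (2 / (p - 1))) *
        ENNReal.ofReal (‖circlePt y - circlePt x‖ ^ (-2 : ℝ)) := by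
  set t := ‖circlePt y - circlePt x‖ with ht
  have ht0 : 0 < t := norm_pos_iff.2 (sub_ne_zero.2 hxy)
  have hp3 : 0 < (p + 3) / 2 := by linarith
  have hle : ∀ r ∈ Ioo (0 : ℝ) 1, ENNReal.ofReal ((1 - r) ^ ((p - 3) / 2)) *
        ENNReal.ofReal (‖circlePt y - r * circlePt x‖ ^ (-((p + 3) / 2))) ≤
      ENNReal.ofReal (3 ^ ((p + 3) / 2)) * ENNReal.ofReal ((1 - r) ^ ((p - 3) / 2) *
        ((1 - r) + t) ^ (-((p + 3) / 2))) := by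
    intro r hr
    have hr1 : 0 < 1 - r := by linarith [hr.2]
    rw [← ENNReal.ofReal_mul (by positivity), ← ENNReal.ofReal_mul (by positivity)]
    refine ENNReal.ofReal_le_ofReal ?_
    have e1 := norm_circlePt_sub_real_mul hr.1.le hr.2.le x y
    rw [← ht] at e1
    have e2 := Real.rpow_le_rpow_of_nonpos (by positivity) e1 (z := -((p + 3) / 2)) (by linarith)
    rw [Real.div_rpow (by positivity) (by norm_num), Real.rpow_neg (by norm_num : (0:ℝ) ≤ 3),
      div_inv_eq_mul] at e2
    calc _ ≤ (1 - r) ^ ((p - 3) / 2) *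
          ((1 - r + t) ^ (-((p + 3) / 2)) * 3 ^ ((p + 3) / 2)) := by gcongr
      _ = _ := by ring
  refine (setLIntegral_mono' measurableSet_Ioo hle).trans ?_
  rw [lintegral_const_mul' _ _ ENNReal.ofReal_ne_top, ENNReal.ofReal_mul (by positivity), mul_assoc]
  gcongr
  have hsub : ∫⁻ r in Ioo (0 : ℝ) 1, ENNReal.ofReal ((1 - r) ^ ((p - 3) / 2) *
        ((1 - r) + t) ^ (-((p + 3) / 2))) = ∫⁻ s in Ioo (0 : ℝ) 1,
        ENNReal.ofReal (s ^ ((p - 3) / 2) * (s + t) ^ (-((p + 3) / 2))) := by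
    have := (Measure.measurePreserving_sub_left (volume : Measure ℝ) 1).setLIntegral_comp_emb
      (MeasurableEquiv.subLeft (1 : ℝ)).measurableEmbedding
      (fun s => ENNReal.ofReal (s ^ ((p - 3) / 2) * (s + t) ^ (-((p + 3) / 2)))) (Ioo 0 1)
    rw [this]
    simp
  rw [hsub, ← ENNReal.ofReal_mul (by have : 0 < p - 1 := by linarith
                                     positivity)]
  exact lintegral_kernel_radial_aux hp ht0

theorem besovEnergy_eq {p : ℝ} (hp : 0 ≤ p) (φ : ℂ → ℂ) :
    besovEnergy p φ = ∫⁻ x in Ioc (0 : ℝ) (2 * π), ∫⁻ y in Ioc (0 : ℝ) (2 * π),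
      ‖φ (circlePt y) - φ (circlePt x)‖ₑ ^ p *
        ENNReal.ofReal (‖circlePt y - circlePt x‖ ^ (-2 : ℝ)) := by
  refine lintegral_congr fun x => lintegral_congr fun y => ?_
  rw [div_eq_mul_inv, ENNReal.ofReal_mul (by positivity),
    ← ENNReal.ofReal_rpow_of_nonneg (norm_nonneg _) hp, ofReal_norm, Real.rpow_neg (norm_nonneg _),
    norm_sub_rev (circlePt x), ← enorm_neg, neg_sub]
  norm_cast

theorem norm_sq_lt_one {z : ℂ} (hz : z ∈ unitDiskSet) : 0 < 1 - ‖z‖ ^ 2 := by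
  have : ‖z‖ < 1 := by simpa [unitDiskSet] using hz
  nlinarith [norm_nonneg z]

theorem gradNorm_nonneg (f : ℂ → ℂ) (z : ℂ) : 0 ≤ gradNorm f z := Real.sqrt_nonneg _

theorem measurable_gradNorm (f : ℂ → ℂ) : Measurable (gradNorm f) := by
  unfold gradNorm
  exact (((measurable_fderiv_apply_const ℝ f 1).norm.pow_const 2).add
    ((measurable_fderiv_apply_const ℝ f Complex.I).norm.pow_const 2)).sqrt

theorem dirichletEnergy_eq {p : ℝ} (hp : 0 ≤ p) (f : ℂ → ℂ) :
    dirichletEnergy p rhoD f unitDiskSet = ∫⁻ z in unitDiskSet,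
      ENNReal.ofReal (gradNorm f z) ^ p * ENNReal.ofReal ((1 - ‖z‖ ^ 2) ^ (p - 2)) := by
  refine setLIntegral_congr_fun isOpen_unitDiskSet.measurableSet fun z hz => ?_
  have h := norm_sq_lt_one hz
  have hg := gradNorm_nonneg f z
  simp only [rhoD, inv_inv]
  rw [ENNReal.ofReal_rpow_of_nonneg hg hp, ← ENNReal.ofReal_mul (by positivity),
    Real.mul_rpow hg h.le, mul_assoc, Real.rpow_sub h, div_eq_mul_inv, inv_pow]
  norm_cast

theorem dirichletEnergy_polar {p : ℝ} (hp : 0 ≤ p) (f : ℂ → ℂ) :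
    dirichletEnergy p rhoD f unitDiskSet = ∫⁻ θ in Ioc (0 : ℝ) (2 * π), ∫⁻ r in Ioo (0 : ℝ) 1,
      ENNReal.ofReal r * (ENNReal.ofReal (gradNorm f (r * circlePt θ)) ^ p *
        ENNReal.ofReal ((1 - r ^ 2) ^ (p - 2))) := by
  have hg := measurable_gradNorm f
  rw [dirichletEnergy_eq hp, lintegral_unitDisk (by fun_prop)]
  refine lintegral_congr fun θ => setLIntegral_congr_fun measurableSet_Ioo fun r hr => ?_
  simp only [norm_real_mul_circlePt hr.1.le]

/-- Pointwise Hölder bound for the weighted gradient of a Poisson integral. -/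
theorem gradNorm_poissonDisk_rpow_le {p : ℝ} (hp : 1 < p) {φ : ℂ → ℂ}
    (hφ : IntegrableOn (fun θ : ℝ => φ (circlePt θ)) (Ioc 0 (2 * π))) {r : ℝ}
    (h0 : 0 < r) (h1 : r < 1) (x : ℝ) :
    ENNReal.ofReal (gradNorm (poissonDisk φ) (r * circlePt x)) ^ p *
        ENNReal.ofReal ((1 - r ^ 2) ^ (p - 2)) ≤
      ENNReal.ofReal (2 ^ p * (4 * 6 ^ (3 / 2 : ℝ)) ^ (p - 1)) *
        ∫⁻ y in Ioc (0 : ℝ) (2 * π), ‖φ (circlePt y) - φ (circlePt x)‖ₑ ^ p *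
          (ENNReal.ofReal ((1 - r) ^ ((p - 3) / 2)) *
          ENNReal.ofReal (‖circlePt y - r * circlePt x‖ ^ (-((p + 3) / 2)))) := by
  have hp0 : 0 < p := by linarith
  have hp1 : 0 < p - 1 := by linarith
  set δ := 1 - r with hδ
  have hδ0 : 0 < δ := by linarith
  have hz := real_mul_circlePt_mem h0.le h1 x
  have hk : ∀ y, 0 < ‖circlePt y - r * circlePt x‖ := fun y =>
    norm_pos_iff.2 (circlePt_sub_ne_zero hz y)
  set k : ℝ → ℝ := fun y => ‖circlePt y - r * circlePt x‖ with hkdef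
  have hkm : Measurable k := by
    have : Continuous k := by simp only [hkdef]; fun_prop
    exact this.measurable
  have hfm : AEMeasurable (fun y => ‖φ (circlePt y) - φ (circlePt x)‖ₑ)
      (volume.restrict (Ioc (0 : ℝ) (2 * π))) :=
    (hφ.aestronglyMeasurable.aemeasurable.sub_const _).enorm
  have hH := lintegral_mul_rpow_le (volume.restrict (Ioc (0 : ℝ) (2 * π))) hp
    (f := fun y => ‖φ (circlePt y) - φ (circlePt x)‖ₑ * ENNReal.ofReal (k y ^ (-((p + 3) / (2 * p)))))
    (g := fun y => ENNReal.ofReal (k y ^ (-(3 * (p - 1) / (2 * p)))))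
    (hfm.mul (by fun_prop)) (by fun_prop)
  have e1 : ∀ y, ‖φ (circlePt y) - φ (circlePt x)‖ₑ * ENNReal.ofReal (k y ^ (-((p + 3) / (2 * p)))) *
      ENNReal.ofReal (k y ^ (-(3 * (p - 1) / (2 * p)))) =
      ‖φ (circlePt y) - φ (circlePt x)‖ₑ * ENNReal.ofReal (k y ^ (-2 : ℝ)) := fun y => by
    rw [mul_assoc, ← ENNReal.ofReal_mul (Real.rpow_nonneg (hk y).le _), ← Real.rpow_add (hk y)]
    congr 3; field_simp; ring
  have e2 : ∀ y, (‖φ (circlePt y) - φ (circlePt x)‖ₑ *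
      ENNReal.ofReal (k y ^ (-((p + 3) / (2 * p))))) ^ p =
      ‖φ (circlePt y) - φ (circlePt x)‖ₑ ^ p * ENNReal.ofReal (k y ^ (-((p + 3) / 2))) := fun y => by
    rw [ENNReal.mul_rpow_of_nonneg _ _ hp0.le,
      ENNReal.ofReal_rpow_of_nonneg (Real.rpow_nonneg (hk y).le _) hp0.le, ← Real.rpow_mul (hk y).le]
    congr 3; field_simp
  have e3 : ∀ y, ENNReal.ofReal (k y ^ (-(3 * (p - 1) / (2 * p)))) ^ (p / (p - 1)) =
      ENNReal.ofReal (k y ^ (-(3 / 2) : ℝ)) := fun y => by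
    rw [ENNReal.ofReal_rpow_of_nonneg (Real.rpow_nonneg (hk y).le _) (by positivity),
      ← Real.rpow_mul (hk y).le]
    congr 2; field_simp
  simp only [e1, e2, e3] at hH
  have hG := ENNReal.rpow_le_rpow (gradNorm_poissonDisk_le hφ hz (φ (circlePt x))) hp0.le
  have hA := ENNReal.rpow_le_rpow (lintegral_kernel_angle_le h0.le h1 x) hp1.le
  have hw : ENNReal.ofReal (4 * 6 ^ (3 / 2 : ℝ) * δ ^ (-(1 / 2) : ℝ)) ^ (p - 1) *
      ENNReal.ofReal ((1 - r ^ 2) ^ (p - 2)) ≤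
      ENNReal.ofReal (2 ^ p * (4 * 6 ^ (3 / 2 : ℝ)) ^ (p - 1)) *
        ENNReal.ofReal (δ ^ ((p - 3) / 2)) := by
    rw [ENNReal.ofReal_rpow_of_nonneg (by positivity) hp1.le, ← ENNReal.ofReal_mul (by positivity),
      ← ENNReal.ofReal_mul (by positivity)]
    refine ENNReal.ofReal_le_ofReal ?_
    have f1 : (1 - r ^ 2) = δ * (1 + r) := by rw [hδ]; ring
    have f2 : (1 + r) ^ (p - 2) ≤ 2 ^ p :=
      (Real.rpow_le_rpow_of_exponent_le (by linarith) (by linarith)).trans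
        (Real.rpow_le_rpow (by linarith) (by linarith) hp0.le)
    have f3 : (δ ^ (-(1 / 2) : ℝ)) ^ (p - 1) * δ ^ (p - 2) = δ ^ ((p - 3) / 2) := by
      rw [← Real.rpow_mul hδ0.le, ← Real.rpow_add hδ0]; congr 1; ring
    rw [f1, Real.mul_rpow hδ0.le (by linarith), Real.mul_rpow (by positivity) (by positivity), ← f3]
    calc _ = (1 + r) ^ (p - 2) * ((4 * 6 ^ (3 / 2 : ℝ)) ^ (p - 1) *
          ((δ ^ (-(1 / 2) : ℝ)) ^ (p - 1) * δ ^ (p - 2))) := by ring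
      _ ≤ 2 ^ p * ((4 * 6 ^ (3 / 2 : ℝ)) ^ (p - 1) *
          ((δ ^ (-(1 / 2) : ℝ)) ^ (p - 1) * δ ^ (p - 2))) := by gcongr
      _ = _ := by ring
  calc _ ≤ ((∫⁻ y in Ioc (0 : ℝ) (2 * π), ‖φ (circlePt y) - φ (circlePt x)‖ₑ ^ p *
          ENNReal.ofReal (k y ^ (-((p + 3) / 2)))) *
        ENNReal.ofReal (4 * 6 ^ (3 / 2 : ℝ) * δ ^ (-(1 / 2) : ℝ)) ^ (p - 1)) *
        ENNReal.ofReal ((1 - r ^ 2) ^ (p - 2)) := by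
        gcongr
        exact hG.trans (hH.trans (by gcongr))
    _ ≤ _ := by
      rw [mul_assoc]
      refine (mul_le_mul_right hw _).trans (le_of_eq ?_)
      rw [mul_comm, mul_assoc, ← lintegral_const_mul'' _ (by fun_prop)]
      congr 1
      refine lintegral_congr fun y => ?_
      ring

theorem dirichletEnergy_poissonDisk_le {p : ℝ} (hp : 1 < p) :
    ∃ C : ℝ≥0∞, C < ⊤ ∧ ∀ φ : ℂ → ℂ,
      IntegrableOn (fun θ : ℝ => φ (circlePt θ)) (Ioc 0 (2 * π)) →
      dirichletEnergy p rhoD (poissonDisk φ) unitDiskSet ≤ C * besovEnergy p φ := by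
  have hp0 : 0 < p := by linarith
  refine ⟨ENNReal.ofReal (2 ^ p * (4 * 6 ^ (3 / 2 : ℝ)) ^ (p - 1)) *
    ENNReal.ofReal (3 ^ ((p + 3) / 2) * (2 / (p - 1))),
    ENNReal.mul_lt_top ENNReal.ofReal_lt_top ENNReal.ofReal_lt_top, fun φ hφ => ?_⟩
  set C1 := ENNReal.ofReal (2 ^ p * (4 * 6 ^ (3 / 2 : ℝ)) ^ (p - 1)) with hC1
  set C2 := ENNReal.ofReal (3 ^ ((p + 3) / 2) * (2 / (p - 1))) with hC2
  have hC1t : C1 ≠ ⊤ := ENNReal.ofReal_ne_top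
  have hC2t : C2 ≠ ⊤ := ENNReal.ofReal_ne_top
  rw [dirichletEnergy_polar hp0.le, besovEnergy_eq hp0.le,
    ← lintegral_const_mul' _ _ (ENNReal.mul_ne_top hC1t hC2t)]
  refine lintegral_mono fun x => ?_
  have hfm : AEMeasurable (fun y => ‖φ (circlePt y) - φ (circlePt x)‖ₑ)
      (volume.restrict (Ioc (0 : ℝ) (2 * π))) :=
    (hφ.aestronglyMeasurable.aemeasurable.sub_const _).enorm
  calc _ ≤ ∫⁻ r in Ioo (0 : ℝ) 1, C1 *
        ∫⁻ y in Ioc (0 : ℝ) (2 * π), ‖φ (circlePt y) - φ (circlePt x)‖ₑ ^ p *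
          (ENNReal.ofReal ((1 - r) ^ ((p - 3) / 2)) *
          ENNReal.ofReal (‖circlePt y - r * circlePt x‖ ^ (-((p + 3) / 2)))) := by
        refine setLIntegral_mono' measurableSet_Ioo fun r hr => ?_
        refine le_trans ?_ (gradNorm_poissonDisk_rpow_le hp hφ hr.1 hr.2 x)
        refine (mul_le_mul_left (ENNReal.ofReal_le_one.2 hr.2.le) _).trans (one_mul _).le
    _ = C1 * ∫⁻ y in Ioc (0 : ℝ) (2 * π), ∫⁻ r in Ioo (0 : ℝ) 1,
        ‖φ (circlePt y) - φ (circlePt x)‖ₑ ^ p *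
          (ENNReal.ofReal ((1 - r) ^ ((p - 3) / 2)) *
          ENNReal.ofReal (‖circlePt y - r * circlePt x‖ ^ (-((p + 3) / 2)))) := by
        rw [lintegral_const_mul' _ _ hC1t, lintegral_lintegral_swap]
        refine AEMeasurable.mul ?_ ?_
        · exact (hfm.comp_snd).pow_const p
        · refine Measurable.aemeasurable ?_
          have : Measurable circlePt := continuous_circlePt.measurable
          fun_prop
    _ ≤ C1 * ∫⁻ y in Ioc (0 : ℝ) (2 * π), C2 * (‖φ (circlePt y) - φ (circlePt x)‖ₑ ^ p *
        ENNReal.ofReal (‖circlePt y - circlePt x‖ ^ (-2 : ℝ))) := by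
        gcongr with y
        by_cases hxy : circlePt y = circlePt x
        · simp [hxy, hp0]
        · rw [lintegral_const_mul _ (by fun_prop)]
          refine (mul_le_mul_right (lintegral_kernel_radial_le hp hxy) _).trans (le_of_eq ?_)
          rw [mul_left_comm]
    _ = _ := by rw [lintegral_const_mul' _ _ hC2t, mul_assoc]

theorem poissonDisk_kernel_nonneg {z : ℂ} (hz : z ∈ unitDiskSet) (θ : ℝ) :
    0 ≤ (1 - ‖z‖ ^ 2) / ‖circlePt θ - z‖ ^ 2 :=
  div_nonneg (norm_sq_lt_one hz).le (by positivity)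

theorem continuous_poisson_kernel {z : ℂ} (hz : z ∈ unitDiskSet) :
    Continuous fun θ => (1 - ‖z‖ ^ 2) / ‖circlePt θ - z‖ ^ 2 := by
  refine Continuous.div continuous_const (by fun_prop) fun θ => ?_
  have := norm_pos_iff.2 (circlePt_sub_ne_zero hz θ)
  positivity

theorem lintegral_poisson_kernel {z : ℂ} (hz : z ∈ unitDiskSet) :
    ∫⁻ θ in Ioc (0 : ℝ) (2 * π), ENNReal.ofReal ((1 - ‖z‖ ^ 2) / ‖circlePt θ - z‖ ^ 2) =
      ENNReal.ofReal (2 * π) := by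
  rw [← ofReal_integral_eq_lintegral_ofReal]
  · have h := integral_poisson_kernel hz
    rw [smul_eq_mul] at h
    congr 1
    have := Real.pi_pos
    field_simp at h
    linarith
  · exact (continuous_poisson_kernel hz).integrableOn_Ioc
  · exact ae_of_all _ fun θ => poissonDisk_kernel_nonneg hz θ

theorem enorm_poissonDisk_sub_rpow_le {p : ℝ} (hp : 1 < p) {φ : ℂ → ℂ}
    (hφ : IntegrableOn (fun θ : ℝ => φ (circlePt θ)) (Ioc 0 (2 * π))) {z : ℂ}
    (hz : z ∈ unitDiskSet) (c : ℂ) :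
    ‖poissonDisk φ z - c‖ₑ ^ p ≤ ENNReal.ofReal (2 * π) ^ (p - 1) *
      ∫⁻ θ in Ioc (0 : ℝ) (2 * π), ‖φ (circlePt θ) - c‖ₑ ^ p *
        ENNReal.ofReal ((1 - ‖z‖ ^ 2) / ‖circlePt θ - z‖ ^ 2) := by
  have hp0 : 0 < p := by linarith
  have hp1 : 0 < p - 1 := by linarith
  set k : ℝ → ℝ := fun θ => (1 - ‖z‖ ^ 2) / ‖circlePt θ - z‖ ^ 2 with hk
  have hk0 : ∀ θ, 0 ≤ k θ := poissonDisk_kernel_nonneg hz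
  have hkm : Measurable k := (continuous_poisson_kernel hz).measurable
  have hfm : AEMeasurable (fun y => ‖φ (circlePt y) - c‖ₑ)
      (volume.restrict (Ioc (0 : ℝ) (2 * π))) :=
    (hφ.aestronglyMeasurable.aemeasurable.sub_const _).enorm
  have hH := lintegral_mul_rpow_le (volume.restrict (Ioc (0 : ℝ) (2 * π))) hp
    (f := fun y => ‖φ (circlePt y) - c‖ₑ * ENNReal.ofReal (k y) ^ (1 / p))
    (g := fun y => ENNReal.ofReal (k y) ^ ((p - 1) / p))
    (hfm.mul (by fun_prop)) (by fun_prop)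
  have e1 : ∀ y, ‖φ (circlePt y) - c‖ₑ * ENNReal.ofReal (k y) ^ (1 / p) *
      ENNReal.ofReal (k y) ^ ((p - 1) / p) = ‖φ (circlePt y) - c‖ₑ * ENNReal.ofReal (k y) :=
    fun y => by
    rw [mul_assoc, ← ENNReal.rpow_add_of_nonneg _ _ (by positivity) (by positivity)]
    have : 1 / p + (p - 1) / p = 1 := by field_simp; ring
    rw [this, ENNReal.rpow_one]
  have e2 : ∀ y, (‖φ (circlePt y) - c‖ₑ * ENNReal.ofReal (k y) ^ (1 / p)) ^ p =
      ‖φ (circlePt y) - c‖ₑ ^ p * ENNReal.ofReal (k y) := fun y => by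
    rw [ENNReal.mul_rpow_of_nonneg _ _ hp0.le, ← ENNReal.rpow_mul, one_div_mul_cancel hp0.ne',
      ENNReal.rpow_one]
  have e3 : ∀ y, (ENNReal.ofReal (k y) ^ ((p - 1) / p)) ^ (p / (p - 1)) =
      ENNReal.ofReal (k y) := fun y => by
    rw [← ENNReal.rpow_mul]
    have : (p - 1) / p * (p / (p - 1)) = 1 := by field_simp
    rw [this, ENNReal.rpow_one]
  simp only [e1, e2, e3] at hH
  rw [lintegral_poisson_kernel hz] at hH
  rw [mul_comm]
  refine le_trans (ENNReal.rpow_le_rpow ?_ hp0.le) hH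
  rw [← poissonDisk_sub_const hφ hz, poissonDisk, enorm_smul]
  have h1 : ‖(2 * π)⁻¹‖ₑ ≤ 1 := by
    rw [← ofReal_norm, Real.norm_of_nonneg (by positivity)]
    refine ENNReal.ofReal_le_one.2 (inv_le_one_of_one_le₀ ?_)
    linarith [Real.pi_gt_three]
  refine (mul_le_mul_left h1 _).trans ?_
  rw [one_mul]
  refine (enorm_integral_le_lintegral_enorm _).trans (le_of_eq (lintegral_congr fun θ => ?_))
  rw [enorm_smul, mul_comm, ← ofReal_norm (_ / _), Real.norm_of_nonneg (hk0 θ)]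

theorem hasNTLimAt_poissonDisk {p : ℝ} (hp : 1 < p) {φ : ℂ → ℂ}
    (hφ : IntegrableOn (fun θ : ℝ => φ (circlePt θ)) (Ioc 0 (2 * π))) {x : ℝ}
    (hx : ∫⁻ y in Ioc (0 : ℝ) (2 * π), ‖φ (circlePt y) - φ (circlePt x)‖ₑ ^ p *
        ENNReal.ofReal (‖circlePt y - circlePt x‖ ^ (-2 : ℝ)) < ⊤) :
    HasNTLimAt (poissonDisk φ) unitDiskSet (φ (circlePt x)) (circlePt x) := by
  intro M hM
  have hp0 : 0 < p := by linarith
  set A := ∫⁻ y in Ioc (0 : ℝ) (2 * π), ‖φ (circlePt y) - φ (circlePt x)‖ₑ ^ p *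
        ENNReal.ofReal (‖circlePt y - circlePt x‖ ^ (-2 : ℝ)) with hA
  set B : ℂ → ℝ≥0∞ := fun z => (ENNReal.ofReal (2 * π) ^ (p - 1) *
    (ENNReal.ofReal (2 * (1 + M) ^ 2 * (1 - ‖z‖)) * A)) ^ (1 / p) with hB
  have hlim : Tendsto B (𝓝[ntRegion unitDiskSet (circlePt x) M] (circlePt x)) (𝓝 0) := by
    have h1 : Tendsto (fun z : ℂ => ENNReal.ofReal (2 * (1 + M) ^ 2 * (1 - ‖z‖)))
        (𝓝[ntRegion unitDiskSet (circlePt x) M] (circlePt x)) (𝓝 0) := by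
      have : Continuous fun z : ℂ => ENNReal.ofReal (2 * (1 + M) ^ 2 * (1 - ‖z‖)) :=
        ENNReal.continuous_ofReal.comp (by fun_prop)
      have h := (this.tendsto (circlePt x)).mono_left
        (nhdsWithin_le_nhds (s := ntRegion unitDiskSet (circlePt x) M))
      simpa using h
    have h2 := ENNReal.Tendsto.const_mul (a := ENNReal.ofReal (2 * π) ^ (p - 1))
      (ENNReal.Tendsto.mul_const h1 (b := A) (Or.inr hx.ne))
      (Or.inr (ENNReal.rpow_ne_top_of_nonneg (by linarith) ENNReal.ofReal_ne_top))
    have h3 := h2.ennrpow_const (1 / p)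
    have h4 : 0 ^ (1 / p) = (0 : ℝ≥0∞) := ENNReal.zero_rpow_of_pos (by positivity)
    rwa [zero_mul, mul_zero, h4] at h3
  rw [tendsto_iff_edist_tendsto_0]
  refine tendsto_of_tendsto_of_tendsto_of_le_of_le' tendsto_const_nhds hlim
    (Eventually.of_forall fun _ => zero_le) ?_
  filter_upwards [self_mem_nhdsWithin] with z hz
  obtain ⟨hzD, hzM⟩ := hz
  have hz1 : ‖z‖ < 1 := by simpa [unitDiskSet] using hzD
  have hzM' : ‖z - circlePt x‖ < M * (1 - ‖z‖) :=
    hzM.trans_le (by gcongr; exact infDist_unitCircle_le hzD)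
  rw [hB, one_div, ENNReal.le_rpow_inv_iff hp0, edist_eq_enorm_sub]
  refine (enorm_poissonDisk_sub_rpow_le hp hφ hzD _).trans ?_
  gcongr
  rw [hA, ← lintegral_const_mul' _ _ ENNReal.ofReal_ne_top]
  refine lintegral_mono fun y => ?_
  by_cases hxy : circlePt y = circlePt x
  · simp [hxy, hp0]
  rw [mul_left_comm, ← ENNReal.ofReal_mul (by nlinarith [sq_nonneg (1 + M)])]
  gcongr
  have hd : 0 < ‖circlePt y - circlePt x‖ := norm_pos_iff.2 (sub_ne_zero.2 hxy)
  have hk : 0 < ‖circlePt y - z‖ := norm_pos_iff.2 (circlePt_sub_ne_zero hzD y)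
  have h1 : ‖circlePt y - circlePt x‖ ≤ (1 + M) * ‖circlePt y - z‖ := by
    have := norm_sub_le_norm_sub_add_norm_sub (circlePt y) z (circlePt x)
    have h2 := mul_le_mul_of_nonneg_left (one_sub_norm_le z y) (by linarith : 0 ≤ M)
    linarith
  rw [Real.rpow_neg hd.le, ← div_eq_mul_inv]
  have h2 : ‖circlePt y - circlePt x‖ ^ (2 : ℝ) = ‖circlePt y - circlePt x‖ ^ 2 := by norm_cast
  rw [h2, div_le_div_iff₀ (by positivity) (by positivity)]
  have h3 : ‖circlePt y - circlePt x‖ ^ 2 ≤ ((1 + M) * ‖circlePt y - z‖) ^ 2 := by gcongr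
  have h4 : 1 - ‖z‖ ^ 2 ≤ 2 * (1 - ‖z‖) := by nlinarith [norm_nonneg z]
  calc _ ≤ 2 * (1 - ‖z‖) * ((1 + M) * ‖circlePt y - z‖) ^ 2 :=
        mul_le_mul h4 h3 (by positivity) (by linarith)
    _ = _ := by ring

theorem isNTBoundaryFun_poissonDisk {p : ℝ} (hp : 1 < p) {φ : ℂ → ℂ} (hφ : MemBesov p φ) :
    IsNTBoundaryFun (poissonDisk φ) unitDiskSet unitCircleSet φ := by
  have hp0 : 0 < p := by linarith
  rw [isNTBoundaryFun_unitDisk_iff]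
  have hu := hφ.1.aestronglyMeasurable.aemeasurable
  have hE := hφ.2
  rw [besovEnergy_eq hp0.le] at hE
  have hm : AEMeasurable (fun x => ∫⁻ y in Ioc (0 : ℝ) (2 * π),
      ‖φ (circlePt y) - φ (circlePt x)‖ₑ ^ p *
        ENNReal.ofReal (‖circlePt y - circlePt x‖ ^ (-2 : ℝ)))
      (volume.restrict (Ioc (0 : ℝ) (2 * π))) := by
    refine AEMeasurable.lintegral_prod_right' (f := fun q : ℝ × ℝ =>
      ‖φ (circlePt q.2) - φ (circlePt q.1)‖ₑ ^ p *
        ENNReal.ofReal (‖circlePt q.2 - circlePt q.1‖ ^ (-2 : ℝ))) ?_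
    refine AEMeasurable.mul (((hu.comp_snd).sub (hu.comp_fst)).enorm.pow_const p) ?_
    have : Measurable circlePt := continuous_circlePt.measurable
    exact Measurable.aemeasurable (by fun_prop)
  filter_upwards [ae_lt_top' hm hE.ne] with x hx
  exact hasNTLimAt_poissonDisk hp hφ.1 hx

theorem lintegral_rpow_Ioo_zero {a s : ℝ} (ha : 0 < a) (hs : 0 ≤ s) :
    ∫⁻ σ in Ioo 0 s, ENNReal.ofReal (σ ^ (a - 1)) = ENNReal.ofReal (s ^ a / a) := by
  have h := lintegral_Ioo_deriv (G := fun σ => σ ^ a / a) (G' := fun σ => σ ^ (a - 1)) hs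
    ((Real.continuous_rpow_const ha.le).continuousOn.div_const a)
    (fun x hx => by
      have := (Real.hasDerivAt_rpow_const (p := a) (Or.inl hx.1.ne')).div_const a
      simpa [ha.ne', mul_div_assoc, mul_div_cancel_left₀] using this)
    (fun x hx => Real.rpow_nonneg hx.1.le _)
  rw [h, Real.zero_rpow ha.ne', zero_div, sub_zero]

theorem lintegral_rpow_tail_le {σ b : ℝ} (hσ : 0 < σ) :
    ∫⁻ s in Ioo σ b, ENNReal.ofReal (s ^ (-(3 / 2) : ℝ)) ≤
      ENNReal.ofReal (2 * σ ^ (-(1 / 2) : ℝ)) := by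
  rcases le_or_gt b σ with hb | hb
  · simp [Ioo_eq_empty (not_lt.2 hb)]
  have h := lintegral_Ioo_deriv (G := fun s => -2 * s ^ (-(1 / 2) : ℝ))
    (G' := fun s => s ^ (-(3 / 2) : ℝ)) hb.le
    (fun x hx => by
      have hx0 : 0 < x := hσ.trans_le hx.1
      exact ((Real.continuousAt_rpow_const x _ (Or.inl hx0.ne')).const_mul (-2)).continuousWithinAt)
    (fun x hx => by
      have := (Real.hasDerivAt_rpow_const (p := -(1 / 2)) (Or.inl (hσ.trans hx.1).ne')).const_mul (-2)
      refine this.congr_deriv ?_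
      rw [← mul_assoc]; norm_num)
    (fun x hx => Real.rpow_nonneg (hσ.trans hx.1).le _)
  rw [h]
  refine ENNReal.ofReal_le_ofReal ?_
  have := Real.rpow_nonneg (hσ.trans hb).le (-(1 / 2) : ℝ)
  linarith

theorem hardy_pointwise {p s : ℝ} (hp : 1 < p) (hs : 0 ≤ s) {g : ℝ → ℝ≥0∞} (hg : Measurable g) :
    (∫⁻ σ in Ioo 0 s, g σ) ^ p ≤ ENNReal.ofReal ((2 * (p - 1)) ^ (p - 1)) *
      (ENNReal.ofReal (s ^ (1 / 2 : ℝ)) *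
      ∫⁻ σ in Ioo 0 s, g σ ^ p * ENNReal.ofReal (σ ^ (p - 3 / 2))) := by
  have hp0 : 0 < p := by linarith
  have hp1 : 0 < p - 1 := by linarith
  have hH := lintegral_mul_rpow_le (volume.restrict (Ioo 0 s)) hp
    (f := fun σ => g σ * ENNReal.ofReal (σ ^ (1 - 3 / (2 * p))))
    (g := fun σ => ENNReal.ofReal (σ ^ (-(1 - 3 / (2 * p)))))
    (by fun_prop) (by fun_prop)
  have e1 : ∫⁻ σ in Ioo 0 s, g σ * ENNReal.ofReal (σ ^ (1 - 3 / (2 * p))) *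
      ENNReal.ofReal (σ ^ (-(1 - 3 / (2 * p)))) = ∫⁻ σ in Ioo 0 s, g σ :=
    setLIntegral_congr_fun measurableSet_Ioo fun σ hσ => by
      rw [mul_assoc, ← ENNReal.ofReal_mul (Real.rpow_nonneg hσ.1.le _), ← Real.rpow_add hσ.1,
        add_neg_cancel, Real.rpow_zero, ENNReal.ofReal_one, mul_one]
  have e2 : ∫⁻ σ in Ioo 0 s, (g σ * ENNReal.ofReal (σ ^ (1 - 3 / (2 * p)))) ^ p =
      ∫⁻ σ in Ioo 0 s, g σ ^ p * ENNReal.ofReal (σ ^ (p - 3 / 2)) :=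
    setLIntegral_congr_fun measurableSet_Ioo fun σ hσ => by
      rw [ENNReal.mul_rpow_of_nonneg _ _ hp0.le,
        ENNReal.ofReal_rpow_of_nonneg (Real.rpow_nonneg hσ.1.le _) hp0.le, ← Real.rpow_mul hσ.1.le]
      congr 3; field_simp
  have e3 : ∫⁻ σ in Ioo 0 s, ENNReal.ofReal (σ ^ (-(1 - 3 / (2 * p)))) ^ (p / (p - 1)) =
      ENNReal.ofReal (s ^ (1 / (2 * (p - 1))) / (1 / (2 * (p - 1)))) := by
    rw [← lintegral_rpow_Ioo_zero (by positivity) hs]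
    refine setLIntegral_congr_fun measurableSet_Ioo fun σ hσ => ?_
    rw [ENNReal.ofReal_rpow_of_nonneg (Real.rpow_nonneg hσ.1.le _) (by positivity),
      ← Real.rpow_mul hσ.1.le]
    congr 2; field_simp; ring
  rw [e1, e2, e3] at hH
  refine hH.trans (le_of_eq ?_)
  rw [mul_comm, ← mul_assoc]
  congr 1
  rw [ENNReal.ofReal_rpow_of_nonneg (by positivity) hp1.le, ← ENNReal.ofReal_mul (by positivity)]
  congr 1
  rw [div_div_eq_mul_div, div_one, Real.mul_rpow (by positivity) (by positivity),
    ← Real.rpow_mul hs, mul_comm]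
  congr 2; field_simp

theorem lintegral_Ioo_swap {b : ℝ} {F : ℝ → ℝ → ℝ≥0∞} (hF : Measurable (Function.uncurry F)) :
    ∫⁻ s in Ioo 0 b, ∫⁻ σ in Ioo 0 s, F s σ = ∫⁻ σ in Ioo 0 b, ∫⁻ s in Ioo σ b, F s σ := by
  have h1 : ∫⁻ s in Ioo 0 b, ∫⁻ σ in Ioo 0 s, F s σ =
      ∫⁻ s in Ioo 0 b, ∫⁻ σ in Ioo 0 b, {q : ℝ × ℝ | q.2 < q.1}.indicator (Function.uncurry F) (s, σ) := by
    refine setLIntegral_congr_fun measurableSet_Ioo fun s hs => ?_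
    rw [← lintegral_indicator measurableSet_Ioo, ← lintegral_indicator measurableSet_Ioo]
    refine lintegral_congr fun σ => ?_
    simp only [indicator, mem_Ioo, mem_ofPred_eq, Function.uncurry]
    have := hs.2
    split_ifs <;> first | rfl | (exfalso; grind)
  have h2 : ∫⁻ σ in Ioo 0 b, ∫⁻ s in Ioo σ b, F s σ =
      ∫⁻ σ in Ioo 0 b, ∫⁻ s in Ioo 0 b, {q : ℝ × ℝ | q.2 < q.1}.indicator (Function.uncurry F) (s, σ) := by
    refine setLIntegral_congr_fun measurableSet_Ioo fun σ hs => ?_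
    rw [← lintegral_indicator measurableSet_Ioo, ← lintegral_indicator measurableSet_Ioo]
    refine lintegral_congr fun s => ?_
    simp only [indicator, mem_Ioo, mem_ofPred_eq, Function.uncurry]
    have := hs.1
    split_ifs <;> first | rfl | (exfalso; grind)
  rw [h1, h2, lintegral_lintegral_swap]
  exact (hF.indicator (measurableSet_lt measurable_snd measurable_fst)).aemeasurable

theorem hardy {p b : ℝ} (hp : 1 < p) {g : ℝ → ℝ≥0∞} (hg : Measurable g) :
    ∫⁻ s in Ioo 0 b, ENNReal.ofReal (s ^ (-2 : ℝ)) * (∫⁻ σ in Ioo 0 s, g σ) ^ p ≤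
      ENNReal.ofReal ((2 * (p - 1)) ^ (p - 1)) * (2 *
        ∫⁻ s in Ioo 0 b, g s ^ p * ENNReal.ofReal (s ^ (p - 2))) := by
  calc _ ≤ ∫⁻ s in Ioo 0 b, ENNReal.ofReal ((2 * (p - 1)) ^ (p - 1)) *
        ∫⁻ σ in Ioo 0 s, ENNReal.ofReal (s ^ (-(3 / 2) : ℝ)) *
          (g σ ^ p * ENNReal.ofReal (σ ^ (p - 3 / 2))) := by
        refine setLIntegral_mono' measurableSet_Ioo fun s hs => ?_
        refine (mul_le_mul_right (hardy_pointwise hp hs.1.le hg) _).trans (le_of_eq ?_)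
        rw [lintegral_const_mul' _ _ ENNReal.ofReal_ne_top, mul_left_comm, ← mul_assoc (ENNReal.ofReal (s ^ (-2 : ℝ))),
          ← ENNReal.ofReal_mul (Real.rpow_nonneg hs.1.le _), ← Real.rpow_add hs.1]
        norm_num
    _ = ENNReal.ofReal ((2 * (p - 1)) ^ (p - 1)) * ∫⁻ σ in Ioo 0 b, ∫⁻ s in Ioo σ b,
        ENNReal.ofReal (s ^ (-(3 / 2) : ℝ)) *
          (g σ ^ p * ENNReal.ofReal (σ ^ (p - 3 / 2))) := by
        rw [lintegral_const_mul' _ _ ENNReal.ofReal_ne_top, lintegral_Ioo_swap]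
        unfold Function.uncurry; fun_prop
    _ ≤ _ := by
        gcongr
        rw [← lintegral_const_mul' _ _ (by norm_num)]
        refine setLIntegral_mono' measurableSet_Ioo fun σ hσ => ?_
        rw [lintegral_mul_const _ (by fun_prop)]
        refine (mul_le_mul_left (lintegral_rpow_tail_le hσ.1) _).trans (le_of_eq ?_)
        rw [ENNReal.ofReal_mul (by norm_num), mul_assoc, mul_left_comm (ENNReal.ofReal (σ ^ _)),
          ← ENNReal.ofReal_mul (Real.rpow_nonneg hσ.1.le _), ← Real.rpow_add hσ.1]
        rw [show -(1 / 2) + (p - 3 / 2) = p - 2 by ring, ENNReal.ofReal_ofNat]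

theorem lintegral_Ioo_rpow_le {p b : ℝ} (hp : 1 < p) (hb : 0 ≤ b) (hb1 : b ≤ 1) {g : ℝ → ℝ≥0∞} (hg : Measurable g) :
    (∫⁻ σ in Ioo 0 b, g σ) ^ p ≤ ENNReal.ofReal ((2 * (p - 1)) ^ (p - 1)) *
      ∫⁻ σ in Ioo 0 b, g σ ^ p * ENNReal.ofReal (σ ^ (p - 2)) := by
  refine (hardy_pointwise hp hb hg).trans ?_
  gcongr
  rw [← one_mul (∫⁻ σ in Ioo 0 b, g σ ^ p * ENNReal.ofReal (σ ^ (p - 2)))]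
  refine mul_le_mul' (ENNReal.ofReal_le_one.2 (Real.rpow_le_one hb hb1 (by norm_num))) ?_
  refine setLIntegral_mono' measurableSet_Ioo fun σ hσ => ?_
  refine mul_le_mul_right ?_ _
  exact ENNReal.ofReal_le_ofReal
    (Real.rpow_le_rpow_of_exponent_ge hσ.1 (hσ.2.le.trans hb1) (by linarith))

theorem measurable_lintegral_Ioo {g : ℝ → ℝ → ℝ≥0∞} (hg : Measurable (Function.uncurry g)) :
    Measurable fun q : ℝ × ℝ => ∫⁻ σ in Ioo 0 q.1, g σ q.2 := by
  have e : (fun q : ℝ × ℝ => ∫⁻ σ in Ioo 0 q.1, g σ q.2) = fun q : ℝ × ℝ => ∫⁻ σ,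
      {w : (ℝ × ℝ) × ℝ | 0 < w.2 ∧ w.2 < w.1.1}.indicator
        (fun w => Function.uncurry g (w.2, w.1.2)) (q, σ) := by
    funext q
    rw [← lintegral_indicator measurableSet_Ioo]
    rfl
  rw [e]
  refine Measurable.lintegral_prod_right' (Measurable.indicator ?_ ?_)
  · exact hg.comp (by fun_prop)
  · exact (measurableSet_lt (f := fun _ : (ℝ × ℝ) × ℝ => (0 : ℝ)) (g := fun w => w.2)
      (by fun_prop) (by fun_prop)).inter
      (measurableSet_lt (f := fun w : (ℝ × ℝ) × ℝ => w.2) (g := fun w => w.1.1)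
      (by fun_prop) (by fun_prop))

theorem measurable_lintegral_arc {g : ℝ → ℝ → ℝ≥0∞} (hg : Measurable (Function.uncurry g)) :
    Measurable fun q : ℝ × ℝ => ∫⁻ τ in Ioc (-|q.1|) |q.1|, g (|q.1| / 8) (q.2 + τ) := by
  have e : (fun q : ℝ × ℝ => ∫⁻ τ in Ioc (-|q.1|) |q.1|, g (|q.1| / 8) (q.2 + τ)) =
      fun q : ℝ × ℝ => ∫⁻ τ, {w : (ℝ × ℝ) × ℝ | -|w.1.1| < w.2 ∧ w.2 ≤ |w.1.1|}.indicator
        (fun w => Function.uncurry g (|w.1.1| / 8, w.1.2 + w.2)) (q, τ) := by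
    funext q
    rw [← lintegral_indicator measurableSet_Ioc]
    rfl
  rw [e]
  have hab : Measurable fun x : ℝ => |x| := continuous_abs.measurable
  refine Measurable.lintegral_prod_right' (Measurable.indicator ?_ ?_)
  · exact hg.comp (by fun_prop)
  · exact (measurableSet_lt (f := fun w : (ℝ × ℝ) × ℝ => -|w.1.1|) (g := fun w => w.2)
      (by fun_prop) (by fun_prop)).inter
      (measurableSet_le (f := fun w : (ℝ × ℝ) × ℝ => w.2) (g := fun w => |w.1.1|)
      (by fun_prop) (by fun_prop))

theorem add_three_rpow_le {p : ℝ} (hp : 0 ≤ p) (a b c : ℝ≥0∞) :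
    (a + b + c) ^ p ≤ 3 ^ p * (a ^ p + b ^ p + c ^ p) := by
  have h : a + b + c ≤ 3 * max (max a b) c := by
    have : (3 : ℝ≥0∞) * max (max a b) c = max (max a b) c + max (max a b) c + max (max a b) c := by
      ring
    rw [this]
    gcongr
    · exact (le_max_left _ _).trans (le_max_left _ _)
    · exact (le_max_right _ _).trans (le_max_left _ _)
    · exact le_max_right _ _
  refine (ENNReal.rpow_le_rpow h hp).trans ?_
  rw [ENNReal.mul_rpow_of_nonneg _ _ hp]
  gcongr
  rcases max_choice (max a b) c with h1 | h1 <;> rw [h1]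
  · rcases max_choice a b with h2 | h2 <;> rw [h2]
    · exact le_self_add.trans le_self_add
    · exact le_add_self.trans le_self_add
  · exact le_add_self

theorem lintegral_scale_le (F : ℝ → ℝ≥0∞) :
    ∫⁻ t in Ioc 0 π, F t ≤ 8 * ∫⁻ s in Ioo (0 : ℝ) (1 / 2), F (8 * s) := by
  have h := lintegral_image_eq_lintegral_abs_deriv_mul (s := Ioo (0 : ℝ) (1 / 2))
    (f := fun s => 8 * s) (f' := fun _ => 8) measurableSet_Ioo
    (fun x _ => by simpa using ((hasDerivAt_id x).const_mul 8).hasDerivWithinAt)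
    (fun x _ y _ h => by simpa using h) F
  have h8 : ENNReal.ofReal |(8 : ℝ)| = 8 := by norm_num
  rw [h8, lintegral_const_mul' _ _ (by norm_num)] at h
  rw [← h]
  refine lintegral_mono_set fun t ht => ⟨t / 8, ⟨by linarith [ht.1], ?_⟩, by simp only; ring⟩
  linarith [ht.2, Real.pi_lt_four]

/-- Averaging over arcs is bounded on `L^p` of the circle. -/
theorem lintegral_arc_rpow_le {p : ℝ} (hp : 1 < p) {g : ℝ → ℝ≥0∞} (hg : Measurable g)
    (hper : Function.Periodic g (2 * π)) {a : ℝ} (ha : 0 ≤ a) :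
    ∫⁻ x in Ioc (0 : ℝ) (2 * π), (∫⁻ τ in Ioc (-a) a, g (x + τ)) ^ p ≤
      ENNReal.ofReal ((2 * a) ^ p) * ∫⁻ x in Ioc (0 : ℝ) (2 * π), g x ^ p := by
  have hp0 : 0 < p := by linarith
  have hp1 : 0 < p - 1 := by linarith
  have hvol : volume (Ioc (-a) a) = ENNReal.ofReal (2 * a) := by
    rw [Real.volume_Ioc]; congr 1; ring
  calc _ ≤ ∫⁻ x in Ioc (0 : ℝ) (2 * π), ENNReal.ofReal (2 * a) ^ (p - 1) *
        ∫⁻ τ in Ioc (-a) a, g (x + τ) ^ p := by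
        refine lintegral_mono fun x => ?_
        have h := lintegral_mul_rpow_le (volume.restrict (Ioc (-a) a)) hp
          (f := fun τ => g (x + τ)) (g := fun _ => 1) (by fun_prop) (by fun_prop)
        simp only [mul_one, ENNReal.one_rpow, lintegral_const, Measure.restrict_apply_univ, one_mul, hvol] at h
        rw [mul_comm]; exact h
    _ = ENNReal.ofReal (2 * a) ^ (p - 1) * ∫⁻ τ in Ioc (-a) a,
        ∫⁻ x in Ioc (0 : ℝ) (2 * π), g (x + τ) ^ p := by
        rw [lintegral_const_mul' _ _ (ENNReal.rpow_ne_top_of_nonneg hp1.le ENNReal.ofReal_ne_top),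
          lintegral_lintegral_swap]
        fun_prop
    _ = _ := by
        have hper' : Function.Periodic (fun x => g x ^ p) (2 * π) := fun x => by
          simp only [hper x]
        have : ∀ τ, ∫⁻ x in Ioc (0 : ℝ) (2 * π), g (x + τ) ^ p =
            ∫⁻ x in Ioc (0 : ℝ) (2 * π), g x ^ p := fun τ => by
          simpa using lintegral_Ioc_periodic_add hper' 0 0 τ
        simp only [this, lintegral_const, Measure.restrict_apply_univ, hvol]
        rw [mul_comm _ (ENNReal.ofReal (2 * a)), ← mul_assoc]
        congr 1
        rcases ha.eq_or_lt with rfl | ha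
        · simp [hp0.ne']
        · rw [ENNReal.ofReal_rpow_of_pos (by positivity), ← ENNReal.ofReal_mul (by positivity)]
          congr 1
          rw [← Real.rpow_add_one (by positivity)]; congr 1; ring



theorem besov_integrand_le {p : ℝ} (hp : 0 ≤ p) {g : ℝ → ℝ → ℝ≥0∞} {u : ℝ → ℂ} {v : ℝ → ℝ → ℂ}
    {x h : ℝ} (hh : |h| ≤ π) (h0 : h ≠ 0)
    (hx : ‖u x - v (|h| / 8) x‖ₑ ≤ ∫⁻ σ in Ioo 0 (|h| / 8), g σ x)
    (hxh : ‖u (x + h) - v (|h| / 8) (x + h)‖ₑ ≤ ∫⁻ σ in Ioo 0 (|h| / 8), g σ (x + h))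
    (hang : ‖v (|h| / 8) (x + h) - v (|h| / 8) x‖ₑ ≤
      ∫⁻ τ in Ioc (-|h|) |h|, g (|h| / 8) (x + τ)) :
    ‖u (x + h) - u x‖ₑ ^ p * ENNReal.ofReal (‖circlePt (x + h) - circlePt x‖ ^ (-2 : ℝ)) ≤
      ENNReal.ofReal ((π / 2) ^ 2) * 3 ^ p * (ENNReal.ofReal (|h| ^ (-2 : ℝ)) *
        ((∫⁻ σ in Ioo 0 (|h| / 8), g σ x) ^ p +
          (∫⁻ τ in Ioc (-|h|) |h|, g (|h| / 8) (x + τ)) ^ p +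
          (∫⁻ σ in Ioo 0 (|h| / 8), g σ (x + h)) ^ p)) := by
  have hpi := Real.pi_pos
  have ha : 0 < |h| := abs_pos.2 h0
  have h1 : ‖u (x + h) - u x‖ₑ ≤ (∫⁻ σ in Ioo 0 (|h| / 8), g σ x) +
      (∫⁻ τ in Ioc (-|h|) |h|, g (|h| / 8) (x + τ)) +
      (∫⁻ σ in Ioo 0 (|h| / 8), g σ (x + h)) := by
    have e : u (x + h) - u x = -(u x - v (|h| / 8) x) + (v (|h| / 8) (x + h) - v (|h| / 8) x) +
      (u (x + h) - v (|h| / 8) (x + h)) := by ring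
    rw [e]
    refine (enorm_add_le _ _).trans (add_le_add ((enorm_add_le _ _).trans (add_le_add ?_ hang)) hxh)
    rwa [enorm_neg]
  have h2 : ENNReal.ofReal (‖circlePt (x + h) - circlePt x‖ ^ (-2 : ℝ)) ≤
      ENNReal.ofReal ((π / 2) ^ 2) * ENNReal.ofReal (|h| ^ (-2 : ℝ)) := by
    rw [← ENNReal.ofReal_mul (by positivity)]
    refine ENNReal.ofReal_le_ofReal ?_
    have := le_norm_circlePt_sub (x := x + h) (y := x) (by simpa using hh)
    rw [add_sub_cancel_left] at this
    refine (Real.rpow_le_rpow_of_nonpos (by positivity) this (by norm_num)).trans (le_of_eq ?_)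
    rw [Real.mul_rpow (by positivity) ha.le, Real.rpow_neg (by positivity), Real.rpow_ofNat]
    field_simp
  calc _ ≤ (3 ^ p * _) * _ := mul_le_mul' ((ENNReal.rpow_le_rpow h1 hp).trans
        (add_three_rpow_le hp _ _ _)) h2
    _ = _ := by ring

theorem trace_estimate_aux {p : ℝ} (hp : 1 < p) {g : ℝ → ℝ → ℝ≥0∞}
    (hg : Measurable (Function.uncurry g)) (hper : ∀ s, Function.Periodic (g s) (2 * π)) (h : ℝ) :
    ∫⁻ x in Ioc (0 : ℝ) (2 * π), ENNReal.ofReal (|h| ^ (-2 : ℝ)) *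
        ((∫⁻ σ in Ioo 0 (|h| / 8), g σ x) ^ p +
          (∫⁻ τ in Ioc (-|h|) |h|, g (|h| / 8) (x + τ)) ^ p +
          (∫⁻ σ in Ioo 0 (|h| / 8), g σ (x + h)) ^ p) ≤
      ENNReal.ofReal (|h| ^ (-2 : ℝ)) *
        (2 * (∫⁻ x in Ioc (0 : ℝ) (2 * π), (∫⁻ σ in Ioo 0 (|h| / 8), g σ x) ^ p) +
        ENNReal.ofReal ((2 * |h|) ^ p) * ∫⁻ x in Ioc (0 : ℝ) (2 * π), g (|h| / 8) x ^ p) := by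
  have hW := measurable_lintegral_Ioo hg
  have hM := measurable_lintegral_arc hg
  have hWx : Measurable fun x => ∫⁻ σ in Ioo 0 (|h| / 8), g σ x :=
    hW.comp (by fun_prop : Measurable fun x : ℝ => (|h| / 8, x))
  have hMx : Measurable fun x => ∫⁻ τ in Ioc (-|h|) |h|, g (|h| / 8) (x + τ) :=
    hM.comp (by fun_prop : Measurable fun x : ℝ => (h, x))
  have hgs : Measurable (g (|h| / 8)) := hg.comp (by fun_prop : Measurable fun x : ℝ => (|h| / 8, x))
  have hWper : Function.Periodic (fun x => (∫⁻ σ in Ioo 0 (|h| / 8), g σ x) ^ p) (2 * π) :=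
    fun x => by simp only [(hper _) x]
  have hsh : ∫⁻ x in Ioc (0 : ℝ) (2 * π), (∫⁻ σ in Ioo 0 (|h| / 8), g σ (x + h)) ^ p =
      ∫⁻ x in Ioc (0 : ℝ) (2 * π), (∫⁻ σ in Ioo 0 (|h| / 8), g σ x) ^ p := by
    simpa using lintegral_Ioc_periodic_add hWper 0 0 h
  have hWM : Measurable fun x => (∫⁻ σ in Ioo 0 (|h| / 8), g σ x) ^ p +
      (∫⁻ τ in Ioc (-|h|) |h|, g (|h| / 8) (x + τ)) ^ p := by fun_prop
  rw [lintegral_const_mul' _ _ ENNReal.ofReal_ne_top,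
    lintegral_add_left hWM,
    lintegral_add_left (hWx.pow_const p), hsh]
  rw [add_right_comm, ← two_mul]
  exact mul_le_mul_right (add_le_add le_rfl
    (lintegral_arc_rpow_le hp hgs (hper _) (abs_nonneg h))) _

theorem trace_estimate_radial {p : ℝ} (hp : 1 < p) {g : ℝ → ℝ → ℝ≥0∞}
    (hg : Measurable (Function.uncurry g)) :
    ∫⁻ s in Ioo (0 : ℝ) (1 / 2), ENNReal.ofReal ((8 * s) ^ (-2 : ℝ)) *
        (2 * (∫⁻ x in Ioc (0 : ℝ) (2 * π), (∫⁻ σ in Ioo 0 (8 * s / 8), g σ x) ^ p) +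
        ENNReal.ofReal ((2 * (8 * s)) ^ p) * ∫⁻ x in Ioc (0 : ℝ) (2 * π), g (8 * s / 8) x ^ p) ≤
      (4 * ENNReal.ofReal ((2 * (p - 1)) ^ (p - 1)) + ENNReal.ofReal (16 ^ p)) *
        ∫⁻ x in Ioc (0 : ℝ) (2 * π), ∫⁻ s in Ioo (0 : ℝ) (1 / 2),
          g s x ^ p * ENNReal.ofReal (s ^ (p - 2)) := by
  have hp0 : 0 < p := by linarith
  have hW := measurable_lintegral_Ioo hg
  have hgx : ∀ x, Measurable fun s => g s x := fun x => hg.comp (by fun_prop : Measurable fun s : ℝ => (s, x))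
  have hgm : Measurable fun q : ℝ × ℝ => g q.1 q.2 := hg
  have hgW : Measurable fun s => ∫⁻ x in Ioc (0 : ℝ) (2 * π), (∫⁻ σ in Ioo 0 s, g σ x) ^ p :=
    Measurable.lintegral_prod_right' (hW.pow_const p)
  calc _ ≤ ∫⁻ s in Ioo (0 : ℝ) (1 / 2), (2 * (ENNReal.ofReal (s ^ (-2 : ℝ)) *
          ∫⁻ x in Ioc (0 : ℝ) (2 * π), (∫⁻ σ in Ioo 0 s, g σ x) ^ p) +
        ENNReal.ofReal (16 ^ p) * ∫⁻ x in Ioc (0 : ℝ) (2 * π), g s x ^ p * ENNReal.ofReal (s ^ (p - 2))) := by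
        refine setLIntegral_mono' measurableSet_Ioo fun s hs => ?_
        have hs0 := hs.1
        have h8 : (8 * s) ^ (-2 : ℝ) ≤ s ^ (-2 : ℝ) :=
          Real.rpow_le_rpow_of_nonpos hs0 (by linarith) (by norm_num)
        rw [show 8 * s / 8 = s by ring, mul_add]
        refine add_le_add ?_ ?_
        · rw [mul_left_comm]
          exact mul_le_mul_right (mul_le_mul_left (ENNReal.ofReal_le_ofReal h8) _) _
        · rw [lintegral_mul_const' _ _ ENNReal.ofReal_ne_top, ← mul_assoc, mul_comm _ (ENNReal.ofReal (s ^ _)),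
            ← mul_assoc (ENNReal.ofReal (16 ^ p)), ← ENNReal.ofReal_mul (by positivity), ← ENNReal.ofReal_mul (by positivity)]
          refine mul_le_mul_left (ENNReal.ofReal_le_ofReal ?_) _
          rw [show 2 * (8 * s) = 16 * s by ring, Real.mul_rpow (x := 16) (by norm_num) hs0.le,
            show p - 2 = -2 + p by ring, Real.rpow_add hs0]
          calc _ ≤ s ^ (-2 : ℝ) * (16 ^ p * s ^ p) := by gcongr
            _ = _ := by ring
    _ = 2 * (∫⁻ x in Ioc (0 : ℝ) (2 * π), ∫⁻ s in Ioo (0 : ℝ) (1 / 2),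
          ENNReal.ofReal (s ^ (-2 : ℝ)) * (∫⁻ σ in Ioo 0 s, g σ x) ^ p) +
        ENNReal.ofReal (16 ^ p) * ∫⁻ x in Ioc (0 : ℝ) (2 * π), ∫⁻ s in Ioo (0 : ℝ) (1 / 2),
          g s x ^ p * ENNReal.ofReal (s ^ (p - 2)) := by
        have hm : Measurable fun s : ℝ => 2 * (ENNReal.ofReal (s ^ (-2 : ℝ)) *
          ∫⁻ x in Ioc (0 : ℝ) (2 * π), (∫⁻ σ in Ioo 0 s, g σ x) ^ p) := by fun_prop
        rw [lintegral_add_left hm, lintegral_const_mul' _ _ (by norm_num),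
          lintegral_const_mul' _ _ ENNReal.ofReal_ne_top]
        congr 2
        · rw [lintegral_lintegral_swap]
          · exact lintegral_congr fun s => (lintegral_const_mul' _ _ ENNReal.ofReal_ne_top).symm
          · exact Measurable.aemeasurable ((by fun_prop : Measurable fun q : ℝ × ℝ => 
              ENNReal.ofReal (q.2 ^ (-2 : ℝ))).mul ((hW.pow_const p).comp measurable_swap))
        · rw [lintegral_lintegral_swap]
          exact Measurable.aemeasurable (by fun_prop)
    _ ≤ 2 * (∫⁻ x in Ioc (0 : ℝ) (2 * π), ENNReal.ofReal ((2 * (p - 1)) ^ (p - 1)) * (2 *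
          ∫⁻ s in Ioo (0 : ℝ) (1 / 2), g s x ^ p * ENNReal.ofReal (s ^ (p - 2)))) + _ := by
        gcongr with x
        exact hardy hp (hgx x)
    _ = _ := by
        rw [lintegral_const_mul' _ _ ENNReal.ofReal_ne_top, lintegral_const_mul' _ _ (by norm_num)]
        ring

theorem trace_estimate {p : ℝ} (hp : 1 < p) : ∃ C : ℝ≥0∞, C < ⊤ ∧
    ∀ (g : ℝ → ℝ → ℝ≥0∞) (u : ℝ → ℂ) (v : ℝ → ℝ → ℂ), Measurable (Function.uncurry g) →
      (∀ s, Function.Periodic (g s) (2 * π)) → Function.Periodic u (2 * π) →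
      (∀ᵐ x, ∀ s ∈ Ioo (0 : ℝ) (1 / 2), ‖u x - v s x‖ₑ ≤ ∫⁻ σ in Ioo 0 s, g σ x) →
      (∀ s ∈ Ioo (0 : ℝ) (1 / 2), ∀ x h,
        ‖v s (x + h) - v s x‖ₑ ≤ ∫⁻ τ in Ioc (-|h|) |h|, g s (x + τ)) →
      ∫⁻ x in Ioc (0 : ℝ) (2 * π), ∫⁻ y in Ioc (0 : ℝ) (2 * π), ‖u y - u x‖ₑ ^ p *
        ENNReal.ofReal (‖circlePt y - circlePt x‖ ^ (-2 : ℝ)) ≤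
      C * ∫⁻ x in Ioc (0 : ℝ) (2 * π), ∫⁻ s in Ioo (0 : ℝ) (1 / 2),
          g s x ^ p * ENNReal.ofReal (s ^ (p - 2)) := by
  have hp0 : 0 < p := by linarith
  set c0 : ℝ≥0∞ := ENNReal.ofReal ((π / 2) ^ 2) * 3 ^ p with hc0
  set c1 : ℝ≥0∞ := 4 * ENNReal.ofReal ((2 * (p - 1)) ^ (p - 1)) + ENNReal.ofReal (16 ^ p) with hc1
  have hc0t : c0 ≠ ⊤ := ENNReal.mul_ne_top ENNReal.ofReal_ne_top
    (ENNReal.rpow_ne_top_of_nonneg hp0.le (by norm_num))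
  have hc1t : c1 ≠ ⊤ := ENNReal.add_ne_top.2
    ⟨ENNReal.mul_ne_top (by norm_num) ENNReal.ofReal_ne_top, ENNReal.ofReal_ne_top⟩
  refine ⟨c0 * (2 * (8 * c1)), (ENNReal.mul_ne_top hc0t (ENNReal.mul_ne_top (by norm_num)
    (ENNReal.mul_ne_top (by norm_num) hc1t))).lt_top, fun g u v hg hper hu hrad hang => ?_⟩
  have hW := measurable_lintegral_Ioo hg
  have hM := measurable_lintegral_arc hg
  have hpi : Ioc (-π) (-π + 2 * π) = Ioc (-π) π := by congr 1; ring
  have hgood : ∀ x : ℝ, ∀ᵐ h : ℝ, ∀ s ∈ Ioo (0 : ℝ) (1 / 2),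
      ‖u (x + h) - v s (x + h)‖ₑ ≤ ∫⁻ σ in Ioo 0 s, g σ (x + h) := fun x =>
    (measurePreserving_add_left volume x).quasiMeasurePreserving.ae hrad
  calc _ = ∫⁻ x in Ioc (0 : ℝ) (2 * π), ∫⁻ h in Ioc (-π) π, ‖u (x + h) - u x‖ₑ ^ p *
        ENNReal.ofReal (‖circlePt (x + h) - circlePt x‖ ^ (-2 : ℝ)) := by
        refine lintegral_congr fun x => ?_
        have hF : Function.Periodic (fun y => ‖u y - u x‖ₑ ^ p *
          ENNReal.ofReal (‖circlePt y - circlePt x‖ ^ (-2 : ℝ))) (2 * π) := fun y => by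
          simp only [hu y, circlePt_periodic y]
        have := lintegral_Ioc_periodic_add hF (-π) 0 x
        rw [hpi, zero_add] at this
        rw [← this]
        simp only [add_comm]
    _ ≤ ∫⁻ x in Ioc (0 : ℝ) (2 * π), ∫⁻ h in Ioc (-π) π, c0 * (ENNReal.ofReal (|h| ^ (-2 : ℝ)) *
        ((∫⁻ σ in Ioo 0 (|h| / 8), g σ x) ^ p +
          (∫⁻ τ in Ioc (-|h|) |h|, g (|h| / 8) (x + τ)) ^ p +
          (∫⁻ σ in Ioo 0 (|h| / 8), g σ (x + h)) ^ p)) := by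
        refine lintegral_mono_ae (ae_restrict_of_ae ?_)
        filter_upwards [hrad] with x hx
        refine lintegral_mono_ae ?_
        rw [ae_restrict_iff' measurableSet_Ioc]
        have hne : ∀ᵐ h : ℝ, h ≠ 0 := by simp [ae_iff]
        filter_upwards [hgood x, hne] with h hh h0 hI
        have hle : |h| ≤ π := abs_le.2 ⟨hI.1.le, hI.2⟩
        have hs : |h| / 8 ∈ Ioo (0 : ℝ) (1 / 2) :=
          ⟨by have := abs_pos.2 h0; positivity, by linarith [Real.pi_lt_four]⟩
        exact besov_integrand_le hp0.le hle h0 (hx _ hs) (hh _ hs) (hang _ hs x h)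
    _ = c0 * ∫⁻ h in Ioc (-π) π, ∫⁻ x in Ioc (0 : ℝ) (2 * π), ENNReal.ofReal (|h| ^ (-2 : ℝ)) *
        ((∫⁻ σ in Ioo 0 (|h| / 8), g σ x) ^ p +
          (∫⁻ τ in Ioc (-|h|) |h|, g (|h| / 8) (x + τ)) ^ p +
          (∫⁻ σ in Ioo 0 (|h| / 8), g σ (x + h)) ^ p) := by
        have hab : Measurable fun x : ℝ => |x| := continuous_abs.measurable
        have m1 : Measurable fun q : ℝ × ℝ => ∫⁻ σ in Ioo 0 (|q.2| / 8), g σ q.1 :=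
          hW.comp (by fun_prop : Measurable fun q : ℝ × ℝ => (|q.2| / 8, q.1))
        have m2 : Measurable fun q : ℝ × ℝ => ∫⁻ σ in Ioo 0 (|q.2| / 8), g σ (q.1 + q.2) :=
          hW.comp (by fun_prop : Measurable fun q : ℝ × ℝ => (|q.2| / 8, q.1 + q.2))
        have m3 : Measurable fun q : ℝ × ℝ =>
            ∫⁻ τ in Ioc (-|q.2|) |q.2|, g (|q.2| / 8) (q.1 + τ) :=
          hM.comp (by fun_prop : Measurable fun q : ℝ × ℝ => (q.2, q.1))
        simp_rw [lintegral_const_mul' _ _ hc0t]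
        rw [lintegral_lintegral_swap]
        exact Measurable.aemeasurable (by fun_prop)
    _ ≤ c0 * ∫⁻ h in Ioc (-π) π, ENNReal.ofReal (|h| ^ (-2 : ℝ)) *
        (2 * (∫⁻ x in Ioc (0 : ℝ) (2 * π), (∫⁻ σ in Ioo 0 (|h| / 8), g σ x) ^ p) +
        ENNReal.ofReal ((2 * |h|) ^ p) * ∫⁻ x in Ioc (0 : ℝ) (2 * π), g (|h| / 8) x ^ p) := by
        gcongr with h
        exact trace_estimate_aux hp hg hper h
    _ ≤ c0 * (2 * (8 * (c1 * ∫⁻ x in Ioc (0 : ℝ) (2 * π), ∫⁻ s in Ioo (0 : ℝ) (1 / 2),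
          g s x ^ p * ENNReal.ofReal (s ^ (p - 2))))) := by
        refine mul_le_mul_right ((lintegral_comp_abs_le (F := fun t => ENNReal.ofReal (t ^ (-2 : ℝ)) *
          (2 * (∫⁻ x in Ioc (0 : ℝ) (2 * π), (∫⁻ σ in Ioo 0 (t / 8), g σ x) ^ p) +
          ENNReal.ofReal ((2 * t) ^ p) * ∫⁻ x in Ioc (0 : ℝ) (2 * π), g (t / 8) x ^ p)) π).trans ?_) _
        refine mul_le_mul_right ((lintegral_scale_le _).trans (mul_le_mul_right ?_ _)) _
        exact trace_estimate_radial hp hg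
    _ = _ := by ring

theorem norm_fderiv_le_gradNorm (f : ℂ → ℂ) (z v : ℂ) :
    ‖fderiv ℝ f z v‖ ≤ ‖v‖ * gradNorm f z := by
  have hv : v = v.re • (1 : ℂ) + v.im • Complex.I := by
    simp [Complex.re_add_im]
  have h1 : ‖fderiv ℝ f z v‖ ≤ |v.re| * ‖fderiv ℝ f z 1‖ + |v.im| * ‖fderiv ℝ f z Complex.I‖ := by
    conv_lhs => rw [hv, map_add, map_smul, map_smul]
    refine (norm_add_le _ _).trans (le_of_eq ?_)
    rw [norm_smul, norm_smul, Real.norm_eq_abs, Real.norm_eq_abs]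
  refine h1.trans (abs_le_of_sq_le_sq ?_ (mul_nonneg (norm_nonneg _) (gradNorm_nonneg _ _)) |> (le_abs_self _).trans)
  rw [mul_pow, gradNorm, Real.sq_sqrt (by positivity), Complex.sq_norm, Complex.normSq_apply]
  nlinarith [sq_nonneg (|v.re| * ‖fderiv ℝ f z Complex.I‖ - |v.im| * ‖fderiv ℝ f z 1‖),
    sq_abs v.re, sq_abs v.im]

theorem enorm_sub_le_lintegral_gradNorm {Φ : ℂ → ℂ} (hΦ : ContDiffOn ℝ 2 Φ unitDiskSet)
    {γ γ' : ℝ → ℂ} {a b : ℝ} (hab : a ≤ b) (hγ : ContDiff ℝ 1 γ)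
    (hd : ∀ t, HasDerivAt γ (γ' t) t) (hγ' : ∀ t ∈ Icc a b, ‖γ' t‖ ≤ 1)
    (hm : ∀ t ∈ Icc a b, γ t ∈ unitDiskSet) :
    ‖Φ (γ b) - Φ (γ a)‖ₑ ≤ ∫⁻ t in Icc a b, ENNReal.ofReal (gradNorm Φ (γ t)) := by
  have hc : ContDiffOn ℝ 1 (fun t => Φ (γ t)) (Icc a b) :=
    (hΦ.of_le (by norm_num)).comp hγ.contDiffOn hm
  refine (enorm_sub_le_lintegral_deriv_of_contDiffOn_Icc hc hab).trans
    (setLIntegral_mono' measurableSet_Icc fun t ht => ?_)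
  have hf : DifferentiableAt ℝ Φ (γ t) :=
    (hΦ.contDiffAt (isOpen_unitDiskSet.mem_nhds (hm t ht))).differentiableAt (by norm_num)
  have h : HasDerivAt (fun t => Φ (γ t)) (fderiv ℝ Φ (γ t) (γ' t)) t :=
    hf.hasFDerivAt.comp_hasDerivAt t (hd t)
  rw [h.deriv, ← ofReal_norm]
  refine ENNReal.ofReal_le_ofReal ((norm_fderiv_le_gradNorm _ _ _).trans ?_)
  exact mul_le_of_le_one_left (gradNorm_nonneg _ _) (hγ' t ht)

/-- The gradient of `Φ` in the coordinates (distance to the circle, angle). -/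
def polarGrad (Φ : ℂ → ℂ) (s θ : ℝ) : ℝ≥0∞ :=
  ENNReal.ofReal (gradNorm Φ (((1 - s : ℝ) : ℂ) * circlePt θ))

theorem measurable_polarGrad (Φ : ℂ → ℂ) : Measurable (Function.uncurry (polarGrad Φ)) := by
  have h : Continuous fun q : ℝ × ℝ => ((1 - q.1 : ℝ) : ℂ) * circlePt q.2 := by fun_prop
  exact ENNReal.measurable_ofReal.comp ((measurable_gradNorm Φ).comp h.measurable)

theorem measurable_polarGrad_left (Φ : ℂ → ℂ) (θ : ℝ) : Measurable fun s => polarGrad Φ s θ :=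
  (measurable_polarGrad Φ).of_uncurry_right

theorem periodic_polarGrad (Φ : ℂ → ℂ) (s : ℝ) : Function.Periodic (polarGrad Φ s) (2 * π) :=
  fun θ => by simp only [polarGrad, circlePt_periodic θ]

theorem hasDerivAt_circlePt (t : ℝ) : HasDerivAt circlePt (circlePt t * Complex.I) t := by
  have h : HasDerivAt (fun t : ℝ => (t : ℂ) * Complex.I) Complex.I t := by
    simpa using (Complex.ofRealCLM.hasDerivAt (x := t)).mul_const Complex.I
  exact h.cexp

theorem contDiff_circlePt : ContDiff ℝ 1 circlePt := by
  unfold circlePt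
  have : ContDiff ℝ 1 fun t : ℝ => (t : ℂ) * Complex.I :=
    Complex.ofRealCLM.contDiff.mul contDiff_const
  exact this.cexp

theorem enorm_radial_sub_le {Φ : ℂ → ℂ} (hΦ : ContDiffOn ℝ 2 Φ unitDiskSet) {s t : ℝ}
    (hs : 0 < s) (hst : s ≤ t) (ht : t < 1) (θ : ℝ) :
    ‖Φ (((1 - s : ℝ) : ℂ) * circlePt θ) - Φ (((1 - t : ℝ) : ℂ) * circlePt θ)‖ₑ ≤
      ∫⁻ σ in Ioo 0 t, polarGrad Φ σ θ := by
  have hd : ∀ σ : ℝ, HasDerivAt (fun σ : ℝ => ((1 - σ : ℝ) : ℂ) * circlePt θ)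
      (-circlePt θ) σ := fun σ => by
    have h1 : HasDerivAt (fun σ : ℝ => 1 - σ) (-1) σ := by
      simpa using (hasDerivAt_id σ).const_sub 1
    simpa using (h1.ofReal_comp).mul_const (circlePt θ)
  have hc : ContDiff ℝ 1 fun σ : ℝ => ((1 - σ : ℝ) : ℂ) * circlePt θ :=
    (Complex.ofRealCLM.contDiff.comp (contDiff_const.sub contDiff_id)).mul contDiff_const
  have h := enorm_sub_le_lintegral_gradNorm hΦ hst hc hd (fun _ _ => by simp) fun σ hσ =>
    real_mul_circlePt_mem (by linarith [hσ.2]) (by linarith [hσ.1]) θ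
  rw [← enorm_neg, neg_sub]
  refine h.trans ?_
  rw [← restrict_Ico_eq_restrict_Icc]
  exact lintegral_mono_set fun σ hσ => ⟨hs.trans_le hσ.1, hσ.2⟩

theorem enorm_angular_sub_le {Φ : ℂ → ℂ} (hΦ : ContDiffOn ℝ 2 Φ unitDiskSet) {s : ℝ}
    (hs : 0 < s) (hs1 : s < 1) (x h : ℝ) :
    ‖Φ (((1 - s : ℝ) : ℂ) * circlePt (x + h)) - Φ (((1 - s : ℝ) : ℂ) * circlePt x)‖ₑ ≤
      ∫⁻ τ in Ioc (-|h|) |h|, polarGrad Φ s (x + τ) := by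
  have hd : ∀ τ : ℝ, HasDerivAt (fun τ : ℝ => ((1 - s : ℝ) : ℂ) * circlePt (x + τ))
      (((1 - s : ℝ) : ℂ) * (circlePt (x + τ) * Complex.I)) τ := fun τ =>
    ((hasDerivAt_circlePt (x + τ)).comp_const_add x τ).const_mul _
  have hc : ContDiff ℝ 1 fun τ : ℝ => ((1 - s : ℝ) : ℂ) * circlePt (x + τ) :=
    contDiff_const.mul (contDiff_circlePt.comp (contDiff_const.add contDiff_id))
  have hn : ∀ τ : ℝ, ‖((1 - s : ℝ) : ℂ) * (circlePt (x + τ) * Complex.I)‖ ≤ 1 := fun τ => by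
    rw [norm_mul, norm_mul, norm_circlePt, Complex.norm_I, Complex.norm_real,
      Real.norm_of_nonneg (by linarith)]
    linarith
  have hm : ∀ τ : ℝ, ((1 - s : ℝ) : ℂ) * circlePt (x + τ) ∈ unitDiskSet := fun τ =>
    real_mul_circlePt_mem (by linarith) (by linarith) _
  rcases le_total 0 h with h0 | h0
  · have := enorm_sub_le_lintegral_gradNorm hΦ h0 hc hd (fun τ _ => hn τ) fun τ _ => hm τ
    rw [add_zero] at this
    refine this.trans ?_
    rw [← restrict_Ioc_eq_restrict_Icc, abs_of_nonneg h0]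
    exact lintegral_mono_set (Ioc_subset_Ioc_left (by linarith))
  · have := enorm_sub_le_lintegral_gradNorm hΦ h0 hc hd (fun τ _ => hn τ) fun τ _ => hm τ
    rw [add_zero] at this
    rw [← enorm_neg, neg_sub]
    refine this.trans ?_
    rw [← restrict_Ioc_eq_restrict_Icc, abs_of_nonpos h0, neg_neg]
    exact lintegral_mono_set (Ioc_subset_Ioc_right (by linarith))

theorem enorm_radial_limit_sub_le {Φ : ℂ → ℂ} (hΦ : ContDiffOn ℝ 2 Φ unitDiskSet) {L : ℂ} {θ : ℝ}
    (hL : Tendsto (fun s : ℝ => Φ (((1 - s : ℝ) : ℂ) * circlePt θ)) (𝓝[>] 0) (𝓝 L)) {t : ℝ}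
    (h0 : 0 < t) (ht : t < 1) :
    ‖L - Φ (((1 - t : ℝ) : ℂ) * circlePt θ)‖ₑ ≤ ∫⁻ σ in Ioo 0 t, polarGrad Φ σ θ := by
  have h := (hL.sub_const (Φ (((1 - t : ℝ) : ℂ) * circlePt θ))).enorm
  refine le_of_tendsto h ?_
  filter_upwards [Ioo_mem_nhdsGT h0] with s hs
  exact enorm_radial_sub_le hΦ hs.1 hs.2.le ht θ

theorem exists_radial_limit {Φ : ℂ → ℂ} (hΦ : ContDiffOn ℝ 2 Φ unitDiskSet) {θ : ℝ}
    (hθ : ∫⁻ σ in Ioo (0 : ℝ) (1 / 2), polarGrad Φ σ θ ≠ ⊤) :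
    ∃ L, Tendsto (fun s : ℝ => Φ (((1 - s : ℝ) : ℂ) * circlePt θ)) (𝓝[>] 0) (𝓝 L) := by
  refine CompleteSpace.complete (f := map (fun s : ℝ => Φ (((1 - s : ℝ) : ℂ) * circlePt θ)) (𝓝[>] 0)) ?_
  rw [EMetric.cauchy_iff]
  refine ⟨NeBot.ne inferInstance, fun ε hε => ?_⟩
  have hsmall : Tendsto (fun t : ℝ => ∫⁻ σ in Ioo 0 t,
      polarGrad Φ σ θ ∂(volume.restrict (Ioo (0 : ℝ) (1 / 2)))) (𝓝[>] 0) (𝓝 0) := by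
    refine tendsto_setLIntegral_zero hθ ?_
    have h1 : Tendsto (fun t : ℝ => ENNReal.ofReal t) (𝓝[>] 0) (𝓝 0) := by
      simpa using (ENNReal.continuous_ofReal.tendsto 0).mono_left nhdsWithin_le_nhds
    refine tendsto_of_tendsto_of_tendsto_of_le_of_le tendsto_const_nhds h1 (fun _ => zero_le)
      fun t => ?_
    refine (Measure.restrict_apply_le _ _).trans ?_
    simp [Real.volume_Ioo]
  obtain ⟨t, ht, ht1, ht2⟩ := ((hsmall.eventually (gt_mem_nhds hε)).and
    (Ioo_mem_nhdsGT (by norm_num : (0 : ℝ) < 1 / 2))).exists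
  rw [Measure.restrict_restrict measurableSet_Ioo,
    inter_eq_left.2 (Ioo_subset_Ioo_right ht2.le)] at ht
  refine ⟨(fun s : ℝ => Φ (((1 - s : ℝ) : ℂ) * circlePt θ)) '' Ioo 0 t,
    image_mem_map (Ioo_mem_nhdsGT ht1), ?_⟩
  have key : ∀ a ∈ Ioo 0 t, ∀ b ∈ Ioo 0 t, a ≤ b →
      edist (Φ (((1 - a : ℝ) : ℂ) * circlePt θ)) (Φ (((1 - b : ℝ) : ℂ) * circlePt θ)) < ε := by
    intro a ha b hb hab
    rw [edist_eq_enorm_sub]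
    refine (enorm_radial_sub_le hΦ ha.1 hab (by linarith [hb.2]) θ).trans_lt (lt_of_le_of_lt ?_ ht)
    exact lintegral_mono_set (Ioo_subset_Ioo_right hb.2.le)
  rintro _ ⟨a, ha, rfl⟩ _ ⟨b, hb, rfl⟩
  rcases le_total a b with h | h
  · exact key a ha b hb h
  · rw [edist_comm]; exact key b hb a ha h

theorem lintegral_polarGrad_le {p : ℝ} (hp : 1 < p) (Φ : ℂ → ℂ) :
    ∫⁻ x in Ioc (0 : ℝ) (2 * π), ∫⁻ s in Ioo (0 : ℝ) (1 / 2),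
      polarGrad Φ s x ^ p * ENNReal.ofReal (s ^ (p - 2)) ≤
      8 * dirichletEnergy p rhoD Φ unitDiskSet := by
  have hp0 : 0 < p := by linarith
  rw [dirichletEnergy_polar hp0.le, ← lintegral_const_mul' _ _ (by norm_num)]
  refine lintegral_mono fun x => ?_
  have h := lintegral_image_eq_lintegral_abs_deriv_mul (s := Ioo (0 : ℝ) (1 / 2))
    (f := fun s => 1 - s) (f' := fun _ => -1) measurableSet_Ioo
    (fun x _ => ((hasDerivAt_id x).const_sub 1).hasDerivWithinAt)
    (fun x _ y _ h => by simpa using h) (fun r => ENNReal.ofReal r *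
      (ENNReal.ofReal (gradNorm Φ (r * circlePt x)) ^ p * ENNReal.ofReal ((1 - r ^ 2) ^ (p - 2))))
  simp only [abs_neg, abs_one, ENNReal.ofReal_one, one_mul] at h
  have hsub : (fun s : ℝ => 1 - s) '' Ioo (0 : ℝ) (1 / 2) ⊆ Ioo 0 1 := by
    rintro _ ⟨s, hs, rfl⟩
    exact ⟨by simp only; linarith [hs.2], by simp only; linarith [hs.1]⟩
  refine le_trans ?_ (mul_le_mul_right (lintegral_mono_set hsub) _)
  rw [h, ← lintegral_const_mul' _ _ (by norm_num)]
  refine setLIntegral_mono' measurableSet_Ioo fun s hs => ?_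
  obtain ⟨h0, h1⟩ := hs
  have hw : ENNReal.ofReal (s ^ (p - 2)) ≤
      8 * (ENNReal.ofReal (1 - s) * ENNReal.ofReal ((1 - (1 - s) ^ 2) ^ (p - 2))) := by
    rw [← ENNReal.ofReal_ofNat, ← ENNReal.ofReal_mul (by linarith), ← ENNReal.ofReal_mul (by norm_num)]
    refine ENNReal.ofReal_le_ofReal ?_
    have e : 1 - (1 - s) ^ 2 = s * (2 - s) := by ring
    have h2 : 1 / 4 ≤ (2 - s) ^ (p - 2) := by
      calc (1 / 4 : ℝ) = 2 ^ (-2 : ℝ) := by norm_num [Real.rpow_neg]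
        _ ≤ (2 - s) ^ (-2 : ℝ) := Real.rpow_le_rpow_of_nonpos (by linarith) (by linarith) (by norm_num)
        _ ≤ _ := Real.rpow_le_rpow_of_exponent_le (by linarith) (by linarith)
    rw [e, Real.mul_rpow h0.le (by linarith)]
    have h3 : 0 ≤ s ^ (p - 2) := Real.rpow_nonneg h0.le _
    have h4 : (1 / 2) * (1 / 4) ≤ (1 - s) * (2 - s) ^ (p - 2) :=
      mul_le_mul (by linarith) h2 (by norm_num) (by linarith)
    nlinarith [mul_le_mul_of_nonneg_left h4 h3]
  calc _ ≤ polarGrad Φ s x ^ p * _ := mul_le_mul_right hw _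
    _ = _ := by rw [polarGrad]; ring

theorem ae_of_periodic {P : ℝ → Prop} (hP : ∀ x, P x → P (x + 2 * π))
    (hP' : ∀ x, P (x + 2 * π) → P x)
    (h : ∀ᵐ x ∂volume.restrict (Ioc (0 : ℝ) (2 * π)), P x) : ∀ᵐ x : ℝ, P x := by
  have hz : ∀ (n : ℤ) x, P (x + n • (2 * π)) → P x := by
    intro n
    induction n using Int.induction_on with
    | zero => simp
    | succ n ih =>
      intro x hx
      refine ih x (hP' _ ?_)
      rwa [add_smul, one_smul, ← add_assoc] at hx
    | pred n ih =>
      intro x hx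
      refine ih x ?_
      have := hP _ hx
      rwa [sub_smul, one_smul, add_assoc, sub_add_cancel] at this
  rw [ae_restrict_iff' measurableSet_Ioc] at h
  have h2 : ∀ᵐ x : ℝ, ∀ n : ℤ, x + n • (2 * π) ∈ Ioc 0 (2 * π) → P (x + n • (2 * π)) :=
    ae_all_iff.2 fun n =>
      (measurePreserving_add_right volume (n • (2 * π))).quasiMeasurePreserving.ae h
  filter_upwards [h2] with x hx
  obtain ⟨n, hn, -⟩ := existsUnique_add_zsmul_mem_Ioc Real.two_pi_pos x 0
  rw [zero_add] at hn
  exact hz n x (hx n hn)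

/-- `φ` is the radial boundary function of `Φ`. -/
def HasRadialLimits (Φ φ : ℂ → ℂ) : Prop :=
  ∀ᵐ θ ∂volume.restrict (Ioc (0 : ℝ) (2 * π)),
    Tendsto (fun s : ℝ => Φ (((1 - s : ℝ) : ℂ) * circlePt θ)) (𝓝[>] 0) (𝓝 (φ (circlePt θ)))

theorem IsNTBoundaryFun.hasRadialLimits {Φ φ : ℂ → ℂ}
    (h : IsNTBoundaryFun Φ unitDiskSet unitCircleSet φ) : HasRadialLimits Φ φ := by
  rw [isNTBoundaryFun_unitDisk_iff] at h
  exact h.mono fun θ hθ => hθ.tendsto_radial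

theorem besovEnergy_le_dirichletEnergy {p : ℝ} (hp : 1 < p) :
    ∃ C : ℝ≥0∞, C < ⊤ ∧ ∀ Φ φ : ℂ → ℂ, ContDiffOn ℝ 2 Φ unitDiskSet → HasRadialLimits Φ φ →
      besovEnergy p φ ≤ C * dirichletEnergy p rhoD Φ unitDiskSet := by
  obtain ⟨C, hC, h⟩ := trace_estimate hp
  refine ⟨C * 8, ENNReal.mul_lt_top hC (by norm_num), fun Φ φ hΦ hφ => ?_⟩
  rw [besovEnergy_eq (by linarith)]
  refine (h (polarGrad Φ) (fun θ => φ (circlePt θ))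
    (fun s θ => Φ (((1 - s : ℝ) : ℂ) * circlePt θ)) (measurable_polarGrad Φ)
    (periodic_polarGrad Φ) (fun θ => by simp only [circlePt_periodic θ]) ?_ ?_).trans ?_
  · have h1 := ae_of_periodic (fun θ hθ => by simpa only [circlePt_periodic θ] using hθ)
      (fun θ hθ => by simpa only [circlePt_periodic θ] using hθ) hφ
    filter_upwards [h1] with θ hθ s hs
    exact enorm_radial_limit_sub_le hΦ hθ hs.1 (by linarith [hs.2])
  · exact fun s hs x h => enorm_angular_sub_le hΦ hs.1 (by linarith [hs.2]) x h
  · rw [mul_assoc]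
    gcongr
    exact lintegral_polarGrad_le hp Φ

theorem lintegral_radial_variation_lt_top {p : ℝ} (hp : 1 < p) {Φ : ℂ → ℂ}
    (hE : dirichletEnergy p rhoD Φ unitDiskSet < ⊤) :
    ∫⁻ θ in Ioc (0 : ℝ) (2 * π), ∫⁻ σ in Ioo (0 : ℝ) (1 / 2), polarGrad Φ σ θ < ⊤ := by
  have h1 : ∀ t : ℝ≥0∞, t ≤ 1 + t ^ p := fun t => by
    rcases le_total t 1 with ht | ht
    · exact ht.trans le_self_add
    · refine le_trans ?_ le_add_self
      simpa using ENNReal.rpow_le_rpow_of_exponent_le ht hp.le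
  have hA := (lintegral_polarGrad_le hp Φ).trans_lt (ENNReal.mul_lt_top (by norm_num) hE)
  calc _ ≤ ∫⁻ θ in Ioc (0 : ℝ) (2 * π), (1 + ENNReal.ofReal ((2 * (p - 1)) ^ (p - 1)) *
        ∫⁻ s in Ioo (0 : ℝ) (1 / 2), polarGrad Φ s θ ^ p * ENNReal.ofReal (s ^ (p - 2))) := by
        refine lintegral_mono fun θ => (h1 _).trans ?_
        gcongr
        exact lintegral_Ioo_rpow_le hp (by norm_num) (by norm_num)
          (measurable_polarGrad_left Φ θ)
    _ = volume (Ioc (0 : ℝ) (2 * π)) + ENNReal.ofReal ((2 * (p - 1)) ^ (p - 1)) *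
        ∫⁻ θ in Ioc (0 : ℝ) (2 * π), ∫⁻ s in Ioo (0 : ℝ) (1 / 2),
          polarGrad Φ s θ ^ p * ENNReal.ofReal (s ^ (p - 2)) := by
        rw [lintegral_add_left measurable_const, lintegral_const_mul' _ _ ENNReal.ofReal_ne_top]
        rw [setLIntegral_one]
    _ < ⊤ := ENNReal.add_lt_top.2 ⟨measure_Ioc_lt_top,
        ENNReal.mul_lt_top ENNReal.ofReal_lt_top hA⟩

theorem measurable_radial_variation (Φ : ℂ → ℂ) :
    Measurable fun θ => ∫⁻ σ in Ioo (0 : ℝ) (1 / 2), polarGrad Φ σ θ := by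
  have h := measurable_lintegral_Ioo (measurable_polarGrad Φ)
  exact h.comp (by fun_prop : Measurable fun θ : ℝ => ((1 / 2 : ℝ), θ))

theorem exists_hasRadialLimits {p : ℝ} (hp : 1 < p) {Φ : ℂ → ℂ}
    (hΦ : ContDiffOn ℝ 2 Φ unitDiskSet) (hE : dirichletEnergy p rhoD Φ unitDiskSet < ⊤) :
    ∃ φ, HasRadialLimits Φ φ := by
  refine ⟨fun ζ => limUnder (𝓝[>] (0 : ℝ)) fun s : ℝ => Φ (((1 - s : ℝ) : ℂ) * ζ), ?_⟩
  filter_upwards [ae_lt_top (measurable_radial_variation Φ)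
    (lintegral_radial_variation_lt_top hp hE).ne] with θ hθ
  exact tendsto_nhds_limUnder (exists_radial_limit hΦ hθ.ne)

theorem integrableOn_radial_majorant {p : ℝ} (hp : 1 < p) {Φ : ℂ → ℂ}
    (hΦ : ContDiffOn ℝ 2 Φ unitDiskSet) (hE : dirichletEnergy p rhoD Φ unitDiskSet < ⊤) :
    IntegrableOn (fun θ : ℝ => ‖Φ (((1 - 1 / 2 : ℝ) : ℂ) * circlePt θ)‖ +
      (∫⁻ σ in Ioo (0 : ℝ) (1 / 2), polarGrad Φ σ θ).toReal) (Ioc 0 (2 * π)) := by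
  refine Integrable.add ?_ (integrable_toReal_of_lintegral_ne_top
    (measurable_radial_variation Φ).aemeasurable (lintegral_radial_variation_lt_top hp hE).ne)
  exact (continuous_comp_circlePt hΦ.continuousOn (by norm_num)
    (by norm_num)).norm.integrableOn_Ioc

theorem norm_le_of_enorm_sub_le {a b : ℂ} {w : ℝ≥0∞} (hw : w < ⊤) (h : ‖a - b‖ₑ ≤ w) :
    ‖a‖ ≤ ‖b‖ + w.toReal := by
  have h1 : ‖a - b‖ ≤ w.toReal := by
    simpa using ENNReal.toReal_mono hw.ne h
  linarith [norm_le_norm_add_norm_sub b a, norm_sub_rev a b]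

theorem HasRadialLimits.integrableOn {p : ℝ} (hp : 1 < p) {Φ φ : ℂ → ℂ}
    (hΦ : ContDiffOn ℝ 2 Φ unitDiskSet) (hE : dirichletEnergy p rhoD Φ unitDiskSet < ⊤)
    (hφ : HasRadialLimits Φ φ) :
    IntegrableOn (fun θ : ℝ => φ (circlePt θ)) (Ioc 0 (2 * π)) := by
  refine (integrableOn_radial_majorant hp hΦ hE).mono' ?_ ?_
  · have hu : Tendsto (fun n : ℕ => 1 / ((n : ℝ) + 1)) atTop (𝓝[>] 0) :=
      tendsto_nhdsWithin_iff.2 ⟨tendsto_one_div_add_atTop_nhds_zero_nat,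
        Eventually.of_forall fun n => by simp only [mem_Ioi]; positivity⟩
    refine aestronglyMeasurable_of_tendsto_ae atTop
      (f := fun (n : ℕ) θ => Φ (((1 - 1 / ((n : ℝ) + 1) : ℝ) : ℂ) * circlePt θ))
      (fun n => ?_) (hφ.mono fun θ hθ => hθ.comp hu)
    have h1 : 1 / ((n : ℝ) + 1) ≤ 1 := by
      rw [div_le_one (by positivity)]; linarith [n.cast_nonneg (α := ℝ)]
    have h2 : 0 < 1 / ((n : ℝ) + 1) := by positivity
    exact (continuous_comp_circlePt hΦ.continuousOn (by linarith)
      (by linarith)).aestronglyMeasurable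
  · filter_upwards [hφ, ae_lt_top (measurable_radial_variation Φ)
      (lintegral_radial_variation_lt_top hp hE).ne] with θ hθ hW
    exact norm_le_of_enorm_sub_le hW
      (enorm_radial_limit_sub_le hΦ hθ (by norm_num) (by norm_num))

theorem HasRadialLimits.poissonDisk_eq {p : ℝ} (hp : 1 < p) {Φ φ : ℂ → ℂ}
    (hΦ : IsHarmonicOn Φ unitDiskSet) (hE : dirichletEnergy p rhoD Φ unitDiskSet < ⊤)
    (hφ : HasRadialLimits Φ φ) {z : ℂ} (hz : z ∈ unitDiskSet) : poissonDisk φ z = Φ z := by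
  have hz1 : ‖z‖ < 1 := by simpa [unitDiskSet] using hz
  set d : ℝ := (1 - ‖z‖) / 2 with hd
  have hd0 : 0 < d := by rw [hd]; linarith
  have hsmall : ∀ᶠ s : ℝ in 𝓝[>] 0, 0 < s ∧ s < d ∧ s < 1 / 2 := by
    filter_upwards [self_mem_nhdsWithin,
      mem_nhdsWithin_of_mem_nhds (Iio_mem_nhds (lt_min hd0 one_half_pos))] with s hs hs'
    exact ⟨hs, (lt_min_iff.1 hs').1, (lt_min_iff.1 hs').2⟩
  have hcont : ∀ s : ℝ, 0 < s → s < d → s < 1 / 2 → ∀ θ,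
      d ≤ ‖((1 - s : ℝ) : ℂ) * circlePt θ - z‖ := fun s h0 h1 h2 θ => by
    have := norm_sub_norm_le (((1 - s : ℝ) : ℂ) * circlePt θ) z
    rw [norm_real_mul_circlePt (by linarith)] at this
    linarith
  have hlim : Tendsto (fun s : ℝ => ∫ θ in Ioc (0 : ℝ) (2 * π),
      (((1 - s) ^ 2 - ‖z‖ ^ 2) / ‖((1 - s : ℝ) : ℂ) * circlePt θ - z‖ ^ 2) •
        Φ (((1 - s : ℝ) : ℂ) * circlePt θ)) (𝓝[>] 0)
      (𝓝 (∫ θ in Ioc (0 : ℝ) (2 * π),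
        ((1 - ‖z‖ ^ 2) / ‖circlePt θ - z‖ ^ 2) • φ (circlePt θ))) := by
    refine tendsto_integral_filter_of_dominated_convergence
      (fun θ => 1 / d ^ 2 * (‖Φ (((1 - 1 / 2 : ℝ) : ℂ) * circlePt θ)‖ +
        (∫⁻ σ in Ioo (0 : ℝ) (1 / 2), polarGrad Φ σ θ).toReal)) ?_ ?_
      ((integrableOn_radial_majorant hp hΦ.1 hE).const_mul _) ?_
    · filter_upwards [hsmall] with s ⟨h0, h1, h2⟩
      have hk : Continuous fun θ : ℝ =>
          ((1 - s) ^ 2 - ‖z‖ ^ 2) / ‖((1 - s : ℝ) : ℂ) * circlePt θ - z‖ ^ 2 :=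
        Continuous.div (by fun_prop) (by fun_prop) fun θ =>
          pow_ne_zero _ (hd0.trans_le (hcont s h0 h1 h2 θ)).ne'
      exact (hk.smul (continuous_comp_circlePt hΦ.1.continuousOn (by linarith)
        (by linarith))).aestronglyMeasurable
    · filter_upwards [hsmall] with s ⟨h0, h1, h2⟩
      filter_upwards [ae_lt_top (measurable_radial_variation Φ)
        (lintegral_radial_variation_lt_top hp hE).ne] with θ hW
      rw [norm_smul]
      refine mul_le_mul ?_ (norm_le_of_enorm_sub_le hW
        (enorm_radial_sub_le hΦ.1 h0 h2.le (by norm_num) θ)) (norm_nonneg _) (by positivity)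
      have hzs : ‖z‖ ≤ 1 - s := by linarith
      rw [norm_div, Real.norm_eq_abs, Real.norm_eq_abs, abs_of_nonneg (sq_nonneg ‖_‖),
        abs_of_nonneg (by nlinarith [norm_nonneg z])]
      gcongr
      · nlinarith [norm_nonneg z]
      · exact hcont s h0 h1 h2 θ
    · filter_upwards [hφ] with θ hθ
      refine Tendsto.smul ?_ hθ
      have hc : ContinuousAt (fun s : ℝ =>
          ((1 - s) ^ 2 - ‖z‖ ^ 2) / ‖((1 - s : ℝ) : ℂ) * circlePt θ - z‖ ^ 2) 0 := by
        refine ContinuousAt.div (by fun_prop) (by fun_prop) ?_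
        simpa using circlePt_sub_ne_zero hz θ
      simpa using hc.tendsto.mono_left nhdsWithin_le_nhds
  unfold poissonDisk
  refine tendsto_nhds_unique (hlim.const_smul (2 * π)⁻¹) (tendsto_const_nhds.congr' ?_)
  filter_upwards [hsmall] with s ⟨h0, h1, h2⟩
  exact (poisson_formula hΦ (by linarith) (by linarith)).symm

theorem dirichletEnergy_congr {p : ℝ} {f g : ℂ → ℂ} (h : EqOn f g unitDiskSet) :
    dirichletEnergy p rhoD f unitDiskSet = dirichletEnergy p rhoD g unitDiskSet := by
  refine setLIntegral_congr_fun isOpen_unitDiskSet.measurableSet fun z hz => ?_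
  have : f =ᶠ[𝓝 z] g := h.eventuallyEq_of_mem (isOpen_unitDiskSet.mem_nhds hz)
  simp only [gradNorm, this.fderiv_eq]

theorem IsNTBoundaryFun.congr_disk {f g φ : ℂ → ℂ} (h : EqOn f g unitDiskSet)
    (hf : IsNTBoundaryFun f unitDiskSet unitCircleSet φ) :
    IsNTBoundaryFun g unitDiskSet unitCircleSet φ :=
  hf.mono fun _ hζ M hM => (hζ M hM).congr' <|
    mem_of_superset self_mem_nhdsWithin fun _ hz => h hz.1

theorem rpow_le_mul_rpow {p : ℝ} (hp : 1 < p) {a b C K : ℝ≥0∞} (h : a ≤ C * b) (hK : C ≤ K) :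
    a ^ (1 / p) ≤ K ^ (1 / p) * b ^ (1 / p) := by
  have h0 : 0 ≤ 1 / p := by positivity
  rw [← ENNReal.mul_rpow_of_nonneg _ _ h0]
  exact ENNReal.rpow_le_rpow (h.trans (by gcongr)) h0

/-- For `p > 1`: every `Φ ∈ HD_p(𝔻)` has nontangential limits a.e.
defining a boundary function in `B_p(𝕊)`, the Poisson integral of any `φ ∈ B_p(𝕊)`
lies in `HD_p(𝔻)`, and `E : HD_p(𝔻) → B_p(𝕊)`, `P : B_p(𝕊) → HD_p(𝔻)` are
Banach-space isomorphisms with `P⁻¹ = E` (modulo constants). -/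
theorem statement9 (p : ℝ) (hp : 1 < p) :
    (∀ Φ : ℂ → ℂ, MemHD p rhoD Φ unitDiskSet →
      ∃ φ : ℂ → ℂ, IsNTBoundaryFun Φ unitDiskSet unitCircleSet φ ∧ MemBesov p φ) ∧
    (∀ φ : ℂ → ℂ, MemBesov p φ → MemHD p rhoD (poissonDisk φ) unitDiskSet) ∧
    -- E and P are bounded with bounded inverses (a Banach isomorphism)
    (∃ C : ℝ≥0∞, 0 < C ∧ C < ⊤ ∧
      ∀ Φ φ : ℂ → ℂ, MemHD p rhoD Φ unitDiskSet →
        IsNTBoundaryFun Φ unitDiskSet unitCircleSet φ →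
        besovNorm p φ ≤ C * dirichletNorm p rhoD Φ unitDiskSet ∧
        dirichletNorm p rhoD Φ unitDiskSet ≤ C * besovNorm p φ) ∧
    -- P ∘ E = id on HD_p(𝔻)
    (∀ Φ φ : ℂ → ℂ, MemHD p rhoD Φ unitDiskSet →
      IsNTBoundaryFun Φ unitDiskSet unitCircleSet φ →
      ∀ z ∈ unitDiskSet, poissonDisk φ z = Φ z) ∧
    -- E ∘ P = id on B_p(𝕊)
    (∀ φ : ℂ → ℂ, MemBesov p φ →
      IsNTBoundaryFun (poissonDisk φ) unitDiskSet unitCircleSet φ) := by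
  obtain ⟨K₁, hK₁, hB⟩ := besovEnergy_le_dirichletEnergy hp
  obtain ⟨K₂, hK₂, hD⟩ := dirichletEnergy_poissonDisk_le hp
  have hp0 : 0 < 1 / p := by positivity
  refine ⟨fun Φ hΦ => ?_, fun φ hφ => ⟨isHarmonicOn_poissonDisk hφ.1,
    (hD φ hφ.1).trans_lt (ENNReal.mul_lt_top hK₂ hφ.2)⟩,
    ⟨(K₁ + K₂ + 1) ^ (1 / p), ENNReal.rpow_pos (by positivity) ?_,
      ENNReal.rpow_lt_top_of_nonneg hp0.le ?_, fun Φ φ hΦ hφ => ?_⟩,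
    fun Φ φ hΦ hφ z hz => hφ.hasRadialLimits.poissonDisk_eq hp hΦ.1 hΦ.2 hz,
    fun φ hφ => isNTBoundaryFun_poissonDisk hp hφ⟩
  · obtain ⟨φ, hφ⟩ := exists_hasRadialLimits hp hΦ.1.1 hΦ.2
    have hm : MemBesov p φ := ⟨hφ.integrableOn hp hΦ.1.1 hΦ.2,
      (hB Φ φ hΦ.1.1 hφ).trans_lt (ENNReal.mul_lt_top hK₁ hΦ.2)⟩
    exact ⟨φ, (isNTBoundaryFun_poissonDisk hp hm).congr_disk
      fun z hz => hφ.poissonDisk_eq hp hΦ.1 hΦ.2 hz, hm⟩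
  · simp [hK₁.ne, hK₂.ne]
  · simp [hK₁.ne, hK₂.ne]
  · have hr := hφ.hasRadialLimits
    refine ⟨rpow_le_mul_rpow hp (hB Φ φ hΦ.1.1 hr) (by rw [add_assoc]; exact le_self_add),
      rpow_le_mul_rpow hp ?_ (C := K₂) (le_add_self.trans le_self_add)⟩
    have h := hD φ (hr.integrableOn hp hΦ.1.1 hΦ.2)
    rwa [dirichletEnergy_congr fun z hz => hr.poissonDisk_eq hp hΦ.1 hΦ.2 hz] at h

end WPPaper
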